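/- arXiv:1503.05803 — 7 statements merged into one kernel-verified Lean document; each statement's English description precedes it below -/
import Mathlib

section
/- Every ring automorphism of F((t)) fixing F pointwise preserves the t-adic valuation ring F[[t]] setwise, i.e. every F-algebra automorphism of F((t)) is a valued-field automorphism. -/
theorem aux_root (F : Type*) [Field F] (u : PowerSeries F)
    (hu : PowerSeries.constantCoeff u = 1) (n : ℕ) (hn : (n : F) ≠ 0) :
    ∃ y : PowerSeries F, y ^ n = u := by
  have hn0 : n ≠ 0 := by rintro rfl; simp at hn
  have H : HenselianRing (PowerSeries F) (Ideal.span {PowerSeries.X}) := inferInstance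
  obtain ⟨a, ha, -⟩ := H.is_henselian (Polynomial.X ^ n - Polynomial.C u)
    (Polynomial.monic_X_pow_sub_C u hn0) 1
    (by
      rw [Ideal.mem_span_singleton, PowerSeries.X_dvd_iff]
      simp [hu])
    (by
      apply IsUnit.map
      rw [PowerSeries.isUnit_iff_constantCoeff]
      simpa [Polynomial.derivative_X_pow] using hn)
  refine ⟨a, ?_⟩
  simpa [Polynomial.IsRoot, sub_eq_zero] using ha

theorem aux_order (F : Type*) [Field F]
    (σ : LaurentSeries F ≃+* LaurentSeries F) (u : PowerSeries F)
    (hu : PowerSeries.constantCoeff u = 1) :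
    (σ (u : LaurentSeries F)).order = 0 := by
  set d := (σ (u : LaurentSeries F)).order with hd
  have key : ∀ n : ℕ, (n : F) ≠ 0 → (n : ℤ) ∣ d := by
    intro n hn
    obtain ⟨y, rfl⟩ := aux_root F u hu n hn
    rw [hd, map_pow, map_pow, HahnSeries.order_pow]
    simp
  have hlt : ∃ n : ℕ, d.natAbs < n ∧ (n : F) ≠ 0 := by
    by_cases h : ((d.natAbs + 1 : ℕ) : F) = 0
    · refine ⟨d.natAbs + 1 + 1, by omega, ?_⟩
      rw [Nat.cast_add, h]
      simp
    · exact ⟨_, by omega, h⟩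
  obtain ⟨n, h1, h2⟩ := hlt
  exact Int.eq_zero_of_dvd_of_natAbs_lt_natAbs (key n h2) (by simpa using h1)

theorem aux_sub (F : Type*) [Field F]
    (σ : LaurentSeries F ≃+* LaurentSeries F)
    (hσ : ∀ c : F, σ (algebraMap F (LaurentSeries F) c) = algebraMap F (LaurentSeries F) c)
    (g : PowerSeries F) : ∃ h : PowerSeries F, (h : LaurentSeries F) = σ (g : LaurentSeries F) := by
  set c := PowerSeries.constantCoeff g - 1 with hc
  have h0 := aux_order F σ (g - PowerSeries.C c) (by simp [hc])
  have h1 := LaurentSeries.X_order_mul_powerSeriesPart (n := 0)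
    (f := σ ((g - PowerSeries.C c : PowerSeries F) : LaurentSeries F)) (by rw [h0]; rfl)
  generalize hP : (PowerSeries.X ^ 0 * _ : PowerSeries F) = P at h1
  have hC : ((PowerSeries.C c : PowerSeries F) : LaurentSeries F)
      = algebraMap F (LaurentSeries F) c := by
    rw [LaurentSeries.algebraMap_apply, PowerSeries.coe_C]
  refine ⟨P + PowerSeries.C c, ?_⟩
  rw [map_add, h1, map_sub, map_sub, hC, hσ, sub_add_cancel]

/-- Schilling, Lemma 1: every ring automorphism of `F((t))` fixing `F`
pointwise preserves the valuation ring `F[[t]]` setwise. -/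
theorem statement5 (F : Type*) [Field F]
    (σ : LaurentSeries F ≃+* LaurentSeries F)
    (hσ : ∀ c : F, σ (algebraMap F (LaurentSeries F) c) = algebraMap F (LaurentSeries F) c) :
    (⇑σ) '' (Set.range (fun g : PowerSeries F => (g : LaurentSeries F)))
      = Set.range (fun g : PowerSeries F => (g : LaurentSeries F)) := by
  ext x
  constructor
  · rintro ⟨_, ⟨g, rfl⟩, rfl⟩
    exact aux_sub F σ hσ g
  · rintro ⟨g, rfl⟩
    refine ⟨σ.symm (g : LaurentSeries F), ?_, by simp⟩
    exact aux_sub F σ.symm (fun c => by rw [RingEquiv.symm_apply_eq, hσ]) g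
end

section
/- The orbit of t under the group of F-algebra automorphisms of F((t)) is exactly the set of uniformisers U = { s ∈ F((t)) : v(s) = 1 }. -/
open PowerSeries in
theorem s6_root {F : Type*} [Field F] (n : ℕ) (hn : (n : F) ≠ 0) (x : PowerSeries F)
    (hx : constantCoeff x = 0) : ∃ y : PowerSeries F, y ^ n = 1 + x := by
  let P : PowerSeries F := (1 + X) ^ n - 1
  have hP : P.constantCoeff = 0 := by simp [P]
  have hP1 : P.coeff 1 = n := by
    have h : (1 + X : PowerSeries F) ^ n = (((1 + Polynomial.X : Polynomial F) ^ n : Polynomial F) :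
        PowerSeries F) := by simp
    simp only [P, map_sub, h, Polynomial.coeff_coe, Polynomial.coeff_one_add_X_pow]
    simp [coeff_one]
  have hu : IsUnit (P.coeff 1) := by rw [hP1]; exact hn.isUnit
  have hQ := subst_substInvOfIsUnit_right P hP hu
  have hQs := HasSubst.substInvOfIsUnit P hu
  have hxs : HasSubst x := HasSubst.of_constantCoeff_zero' hx
  set Q := substInvOfIsUnit P hu
  rw [← coe_substAlgHom hQs] at hQ
  simp only [P, map_sub, map_pow, map_add, map_one] at hQ
  have h2 := congrArg (substAlgHom (R := F) hxs) hQ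
  rw [substAlgHom_X] at h2
  simp only [map_sub, map_pow, map_add, map_one, substAlgHom_X] at h2
  exact ⟨1 + substAlgHom hxs Q, sub_eq_iff_eq_add'.mp h2⟩

theorem s6_order_nonneg {F : Type*} [Field F] (p : PowerSeries F) :
    0 ≤ (HahnSeries.ofPowerSeries ℤ F p).order := by
  by_contra h
  push Not at h
  have hne : HahnSeries.ofPowerSeries ℤ F p ≠ 0 := by
    intro h0; rw [h0] at h; simp at h
  have := HahnSeries.coeff_order_eq_zero.not.mpr hne
  rw [PowerSeries.coeff_coe, if_pos h] at this
  exact this rfl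

theorem s6_mem {F : Type*} [Field F] (f : LaurentSeries F) (hf : 0 ≤ f.order) :
    ∃ p, HahnSeries.ofPowerSeries ℤ F p = f := by
  obtain ⟨n, hn⟩ := Int.eq_ofNat_of_zero_le hf
  exact ⟨_, LaurentSeries.X_order_mul_powerSeriesPart hn.symm⟩

theorem s6_max {F : Type*} [Field F] (σ : LaurentSeries F ≃ₐ[F] LaurentSeries F)
    (x : PowerSeries F) (hx : PowerSeries.constantCoeff x = 0) :
    ∃ p, HahnSeries.ofPowerSeries ℤ F p = σ (HahnSeries.ofPowerSeries ℤ F x) := by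
  have key : (σ (HahnSeries.ofPowerSeries ℤ F (1 + x))).order = 0 := by
    set v := (σ (HahnSeries.ofPowerSeries ℤ F (1 + x))).order with hv
    obtain ⟨n, hn, hlt⟩ : ∃ n : ℕ, (n : F) ≠ 0 ∧ v.natAbs < n := by
      by_cases h : ((v.natAbs + 1 : ℕ) : F) = 0
      · refine ⟨v.natAbs + 1 + 1, ?_, by omega⟩
        rw [Nat.cast_add, h]; simp
      · exact ⟨_, h, by omega⟩
    obtain ⟨y, hy⟩ := s6_root n hn x hx
    rw [← hy, map_pow, map_pow, HahnSeries.order_pow] at hv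
    have hd : (n : ℤ) ∣ v := ⟨_, hv.trans (nsmul_eq_mul _ _)⟩
    exact Int.eq_zero_of_abs_lt_dvd hd (by rw [Int.abs_eq_natAbs]; exact_mod_cast hlt)
  obtain ⟨p, hp⟩ := s6_mem _ key.ge
  refine ⟨p - 1, ?_⟩
  rw [map_sub, hp]
  simp

theorem s6_int {F : Type*} [Field F] (σ : LaurentSeries F ≃ₐ[F] LaurentSeries F)
    (x : PowerSeries F) :
    ∃ p, HahnSeries.ofPowerSeries ℤ F p = σ (HahnSeries.ofPowerSeries ℤ F x) := by
  obtain ⟨p, hp⟩ := s6_max σ (x - PowerSeries.C (PowerSeries.constantCoeff x)) (by simp)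
  refine ⟨p + PowerSeries.C (PowerSeries.constantCoeff x), ?_⟩
  have h := σ.commutes (PowerSeries.constantCoeff x)
  rw [LaurentSeries.algebraMap_apply] at h
  rw [map_add, hp, map_sub, map_sub, HahnSeries.ofPowerSeries_C, h]
  simp

theorem s6_max' {F : Type*} [Field F] (σ : LaurentSeries F ≃ₐ[F] LaurentSeries F) :
    ∃ g, HahnSeries.ofPowerSeries ℤ F (PowerSeries.X * g) = σ (HahnSeries.single 1 1) := by
  obtain ⟨q, hq⟩ := s6_int σ PowerSeries.X
  rw [HahnSeries.ofPowerSeries_X] at hq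
  have h0 : PowerSeries.constantCoeff q = 0 := by
    by_contra h
    have hinv := PowerSeries.mul_inv_cancel q h
    obtain ⟨r, hr⟩ := s6_int σ.symm q⁻¹
    have h1 : HahnSeries.ofPowerSeries ℤ F (PowerSeries.X * r) = HahnSeries.ofPowerSeries ℤ F 1 := by
      rw [map_mul, hr, HahnSeries.ofPowerSeries_X, ← σ.symm_apply_apply (HahnSeries.single 1 1),
        ← hq, ← map_mul, ← map_mul, hinv]
      simp
    have h2 := congrArg PowerSeries.constantCoeff (HahnSeries.ofPowerSeries_injective h1)
    simp at h2
  obtain ⟨g, hg⟩ := PowerSeries.X_dvd_iff.mpr h0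
  exact ⟨g, by rw [← hg, hq]⟩

open PowerSeries in
theorem s6_exists {F : Type*} [Field F] (p : PowerSeries F) (h0 : constantCoeff p = 0)
    (h1 : coeff 1 p ≠ 0) : ∃ σ : LaurentSeries F ≃ₐ[F] LaurentSeries F,
      σ (HahnSeries.single 1 1) = HahnSeries.ofPowerSeries ℤ F p := by
  have hu : IsUnit (p.coeff 1) := h1.isUnit
  have hps : HasSubst p := HasSubst.of_constantCoeff_zero' h0
  have hQs := HasSubst.substInvOfIsUnit p hu
  let e : PowerSeries F ≃ₐ[F] PowerSeries F :=
    AlgEquiv.ofAlgHom (substAlgHom hps) (substAlgHom hQs)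
      (by
        ext1 f
        simp only [AlgHom.comp_apply, AlgHom.id_apply, coe_substAlgHom]
        rw [subst_comp_subst_apply hQs hps, subst_substInvOfIsUnit_left p h0 hu, X_subst])
      (by
        ext1 f
        simp only [AlgHom.comp_apply, AlgHom.id_apply, coe_substAlgHom]
        rw [subst_comp_subst_apply hps hQs, subst_substInvOfIsUnit_right p h0 hu, X_subst])
  let r : LaurentSeries F ≃+* LaurentSeries F :=
    IsFractionRing.ringEquivOfRingEquiv (A := PowerSeries F) (B := PowerSeries F) e.toRingEquiv
  have hr : ∀ f : PowerSeries F, r (HahnSeries.ofPowerSeries ℤ F f) =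
      HahnSeries.ofPowerSeries ℤ F (e f) := fun f =>
    IsFractionRing.ringEquivOfRingEquiv_algebraMap (K := LaurentSeries F)
      (L := LaurentSeries F) e.toRingEquiv f
  refine ⟨AlgEquiv.ofRingEquiv (f := r) ?_, ?_⟩
  · intro c
    rw [LaurentSeries.algebraMap_apply, ← HahnSeries.ofPowerSeries_C, hr]
    congr 1
    exact e.commutes c
  · change r _ = _
    rw [← HahnSeries.ofPowerSeries_X, hr]
    congr 1
    exact substAlgHom_X hps

/-- the orbit of `t` under the group of `F`-algebra automorphisms of
`F((t))` is exactly the set of uniformisers, i.e. elements of valuation `1`. -/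
theorem statement6 (F : Type*) [Field F] :
    {s : LaurentSeries F |
        ∃ σ : LaurentSeries F ≃ₐ[F] LaurentSeries F, σ (HahnSeries.single 1 1) = s}
      = {s : LaurentSeries F | s ≠ 0 ∧ s.order = 1} := by
  ext s
  simp only [Set.mem_ofPred_eq]
  constructor
  · rintro ⟨σ, rfl⟩
    have hne1 : (HahnSeries.single 1 1 : LaurentSeries F) ≠ 0 := by simp
    have ho1 : (HahnSeries.single 1 1 : LaurentSeries F).order = 1 :=
      HahnSeries.order_single one_ne_zero
    have hne : σ (HahnSeries.single 1 1) ≠ 0 := (map_ne_zero_iff σ σ.injective).mpr hne1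
    refine ⟨hne, ?_⟩
    obtain ⟨g, hg⟩ := s6_max' σ
    obtain ⟨k, hk⟩ := s6_max' σ.symm
    obtain ⟨h, hh⟩ := s6_int σ k
    rw [map_mul, HahnSeries.ofPowerSeries_X] at hg hk
    have hk2 := congrArg σ hk
    rw [map_mul, ← hh, σ.apply_symm_apply] at hk2
    have e1 := congrArg HahnSeries.order hk2
    have e2 := congrArg HahnSeries.order hg
    rw [HahnSeries.order_mul hne (by rintro h0; rw [h0, mul_zero] at hk2; exact hne1 hk2.symm),
      ho1] at e1
    rw [HahnSeries.order_mul hne1 (by rintro h0; rw [h0, mul_zero] at hg; exact hne hg.symm),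
      ho1] at e2
    have := s6_order_nonneg g
    have := s6_order_nonneg h
    omega
  · rintro ⟨hs, ho⟩
    have hp := LaurentSeries.X_order_mul_powerSeriesPart (n := 1) (f := s) (by simp [ho])
    rw [pow_one] at hp
    obtain ⟨σ, hσ⟩ := s6_exists (PowerSeries.X * s.powerSeriesPart) (by simp) (by
      have := HahnSeries.coeff_order_eq_zero.not.mpr hs
      rw [← zero_add 1, PowerSeries.coeff_succ_X_mul]
      simpa using this)
    exact ⟨σ, hσ.trans hp⟩
end

section
/- Let F be a perfect field of characteristic p > 0, let a ∈ F((t)) with a ∉ F((t))^p, and let n < ω. Then there exists N < ω such that the open ball B(N; a) = { x ∈ F((t)) : v(x - a) > N } is contained in the orbit Orb_n(a) of a under the group G_n of F-automorphisms of F((t)) induced by substitutions t ↦ s with s ∈ t + M^n. -/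
namespace S7
open PowerSeries

variable {F : Type*} [Field F]

lemma hs_of_dvd {s : PowerSeries F} {k : ℕ} (hk : 1 ≤ k) (h : (X : PowerSeries F) ^ k ∣ s - X) :
    constantCoeff s = 0 := by
  have h1 : (X : PowerSeries F) ∣ s - X := (dvd_pow_self X (by omega)).trans h
  have h2 : (X : PowerSeries F) ∣ s := by simpa using dvd_add h1 (dvd_refl X)
  exact X_dvd_iff.1 h2

lemma subst_approx (a : PowerSeries F) (K : ℕ) {s : PowerSeries F} (hs : constantCoeff s = 0) :
    (X : PowerSeries F) ^ K ∣ subst s a - ((trunc K a).map (algebraMap F (PowerSeries F))).eval s := by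
  have hS : HasSubst s := HasSubst.of_constantCoeff_zero' hs
  have h : subst s a = s ^ K * subst s (mk fun i ↦ coeff (i + K) a) +
      ((trunc K a).map (algebraMap F (PowerSeries F))).eval s := by
    conv_lhs => rw [eq_X_pow_mul_shift_add_trunc K a]
    rw [subst_add hS, subst_mul hS, subst_pow hS, subst_X hS, subst_coe hS,
      Polynomial.eval_map_algebraMap]
  rw [h, add_sub_cancel_right]
  exact (pow_dvd_pow_of_dvd (X_dvd_iff.2 hs) K).mul_right _

/-- differences -/
lemma subst_sub_dvd (a : PowerSeries F) (m : ℕ) {s r : PowerSeries F} (hs : constantCoeff s = 0)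
    (hr : constantCoeff r = 0) (h : (X : PowerSeries F) ^ m ∣ s - r) :
    (X : PowerSeries F) ^ m ∣ subst s a - subst r a := by
  have h1 := subst_approx a m hs
  have h2 := subst_approx a m hr
  obtain ⟨z, hz⟩ := Polynomial.evalSubFactor ((trunc m a).map (algebraMap F (PowerSeries F))) s r
  have h3 := h.mul_left z
  rw [← hz] at h3
  have := dvd_sub (dvd_add h1 h3) h2
  convert this using 1
  ring

lemma taylor (a : PowerSeries F) (m : ℕ) {s δ : PowerSeries F} (hs : constantCoeff s = 0)
    (hd : constantCoeff δ = 0) (h : (X : PowerSeries F) ^ m ∣ δ ^ 2) :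
    (X : PowerSeries F) ^ m ∣ subst (s + δ) a - subst s a - subst s (derivative F a) * δ := by
  have h1 := (pow_dvd_pow X (Nat.le_succ m)).trans (subst_approx a (m+1) hs)
  have h2 := (pow_dvd_pow X (Nat.le_succ m)).trans
    (subst_approx a (m+1) (s := s + δ) (by simp [hs, hd]))
  have h3 := subst_approx (derivative F a) m hs
  rw [trunc_derivative, ← Polynomial.derivative_map] at h3
  obtain ⟨z, hz⟩ := Polynomial.binomExpansion
    ((trunc (m+1) a).map (algebraMap F (PowerSeries F))) s δ
  have h4 := h.mul_left z
  rw [hz] at h2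
  have := dvd_sub (dvd_add (dvd_sub h2 h1) h4) (h3.mul_right δ)
  convert this using 1
  ring

lemma step {a e x s : PowerSeries F} {d k j : ℕ} (hk : d + 1 ≤ k) (he : IsUnit e)
    (ha : derivative F a = X ^ d * e) (hs : X ^ k ∣ s - X) (hx : X ^ (k + d + j) ∣ subst s a - x) :
    ∃ s', X ^ (k + j) ∣ s' - s ∧ X ^ (k + d + (j + 1)) ∣ subst s' a - x := by
  obtain ⟨u, rfl⟩ := he
  obtain ⟨r, hr⟩ := hx
  have hs0 := hs_of_dvd (by omega) hs
  set δ : PowerSeries F := X ^ (k + j) * (-r * ((u⁻¹ : (PowerSeries F)ˣ) : PowerSeries F)) with hδ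
  have hdv : X ^ (k + j) ∣ δ := dvd_mul_right _ _
  have hd0 : constantCoeff δ = 0 :=
    X_dvd_iff.1 ((dvd_pow_self X (by omega : k + j ≠ 0)).trans hdv)
  refine ⟨s + δ, by simpa using hdv, ?_⟩
  have h1 : X ^ (k + d + (j + 1)) ∣ δ ^ 2 := by
    refine (pow_dvd_pow X (by omega : k + d + (j+1) ≤ (k + j) * 2)).trans ?_
    rw [pow_mul]; exact pow_dvd_pow_of_dvd hdv 2
  have h2 := taylor a _ hs0 hd0 h1
  have h3 := subst_sub_dvd (derivative F a) k hs0 (r := X) (by simp) hs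
  rw [X_subst] at h3
  have h4 := mul_dvd_mul h3 hdv
  rw [← pow_add] at h4
  have h5 := (pow_dvd_pow X (by omega : k + d + (j+1) ≤ k + (k + j))).trans h4
  have h6 := dvd_add h2 h5
  convert h6 using 1
  have h7 : derivative F a * δ = - (subst s a - x) := by
    rw [ha, hr, hδ]
    have : (u : PowerSeries F) * (u⁻¹ : (PowerSeries F)ˣ) = 1 := u.mul_inv
    linear_combination (- X ^ (k + d + j) * r) * this
  linear_combination h7

lemma eq_of_dvd {f g : PowerSeries F} (h : ∀ j : ℕ, X ^ j ∣ f - g) : f = g := by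
  ext i
  have := X_pow_dvd_iff.1 (h (i+1)) i (by omega)
  simpa [sub_eq_zero] using this

lemma newton {a e x : PowerSeries F} {d k : ℕ} (hk : d + 1 ≤ k) (he : IsUnit e)
    (ha : derivative F a = X ^ d * e) (hx : X ^ (k + d) ∣ a - x) :
    ∃ s, X ^ k ∣ s - X ∧ subst s a = x := by
  classical
  have hstep : ∀ (j : ℕ) (s : {s : PowerSeries F // X ^ k ∣ s - X ∧ X ^ (k + d + j) ∣ subst s a - x}),
      ∃ s' : {s : PowerSeries F // X ^ k ∣ s - X ∧ X ^ (k + d + (j+1)) ∣ subst s a - x},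
        X ^ (k + j) ∣ s'.1 - s.1 := by
    rintro j ⟨s, h1, h2⟩
    obtain ⟨s', h3, h4⟩ := step hk he ha h1 h2
    refine ⟨⟨s', ?_, h4⟩, h3⟩
    have := dvd_add ((pow_dvd_pow X (by omega : k ≤ k + j)).trans h3) h1
    simpa using this
  choose g hg using hstep
  let w : ∀ j : ℕ, {s : PowerSeries F // X ^ k ∣ s - X ∧ X ^ (k + d + j) ∣ subst s a - x} :=
    fun j => Nat.rec ⟨X, by simp, by simpa [X_subst] using hx⟩ (fun j s => g j s) j
  have hw : ∀ j, X ^ j ∣ (w (j+1)).1 - (w j).1 := fun j =>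
    (pow_dvd_pow X (by omega : j ≤ k + j)).trans (hg j (w j))
  have hw2 : ∀ j i, X ^ j ∣ (w (j+i)).1 - (w j).1 := by
    intro j i
    induction i with
    | zero => simp
    | succ i ih =>
      have := dvd_add ((pow_dvd_pow X (by omega : j ≤ j + i)).trans (hw (j+i))) ih
      rw [sub_add_sub_cancel] at this
      exact this
  let s : PowerSeries F := mk fun i => coeff i (w (i+1)).1
  have hsw : ∀ j, X ^ j ∣ s - (w j).1 := by
    intro j
    rw [X_pow_dvd_iff]
    intro i hi
    have h := X_pow_dvd_iff.1 (hw2 (i+1) (j - (i+1))) i (by omega)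
    rw [show i + 1 + (j - (i+1)) = j by omega] at h
    simp only [map_sub, s, coeff_mk] at h ⊢
    linear_combination -h
  have hsX : X ^ k ∣ s - X := by
    have := dvd_add (hsw k) (w k).2.1
    simpa using this
  refine ⟨s, hsX, eq_of_dvd fun j => ?_⟩
  have h1 := subst_sub_dvd a j (hs_of_dvd (by omega) hsX) (hs_of_dvd (by omega) (w j).2.1) (hsw j)
  have h2 := (pow_dvd_pow X (by omega : j ≤ k + d + j)).trans (w j).2.2
  simpa using dvd_add h1 h2

/-- zero derivative implies p-th power -/
lemma pth_power (p : ℕ) [Fact (Nat.Prime p)] [CharP F p] [PerfectRing F p]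
    (a : PowerSeries F) (h : derivative F a = 0) : ∃ b : PowerSeries F, b ^ p = a := by
  have hp : p ≠ 0 := (Fact.out : Nat.Prime p).ne_zero
  refine ⟨mk fun i => (frobeniusEquiv F p).symm (coeff (p * i) a), ?_⟩
  have := MvPowerSeries.map_frobenius_expand (R := F) (σ := Unit) p hp
    (f := (mk fun i => (frobeniusEquiv F p).symm (coeff (p * i) a) : PowerSeries F))
  refine this.symm.trans ?_
  change PowerSeries.map (frobenius F p) (PowerSeries.expand p hp _) = a
  ext i
  rw [coeff_map]
  by_cases hi : p ∣ i
  · obtain ⟨i, rfl⟩ := hi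
    rw [coeff_expand_mul, coeff_mk, frobenius_apply_frobeniusEquiv_symm]
  · rw [coeff_expand_of_not_dvd _ _ _ hi, map_zero]
    rcases i with _ | i
    · simp at hi
    have := congrArg (coeff i) h
    rw [coeff_derivative, map_zero, mul_eq_zero] at this
    rcases this with h0 | h0
    · exact h0.symm
    · exact absurd ((CharP.cast_eq_zero_iff F p (i+1)).1 (by exact_mod_cast h0)) hi

/-- The automorphism of Laurent series. -/
lemma exists_aut {s : PowerSeries F} (hs : X ^ 2 ∣ s - X) :
    ∃ σ : LaurentSeries F ≃ₐ[F] LaurentSeries F, ∀ f : PowerSeries F,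
      σ (algebraMap (PowerSeries F) (LaurentSeries F) f) =
        algebraMap (PowerSeries F) (LaurentSeries F) (subst s f) := by
  have h0 : constantCoeff s = 0 := hs_of_dvd (by norm_num) hs
  have h1 : IsUnit (coeff 1 s) := by
    have := X_pow_dvd_iff.1 hs 1 (by norm_num)
    rw [map_sub, sub_eq_zero] at this
    rw [this]; simp
  have hS : HasSubst s := HasSubst.of_constantCoeff_zero' h0
  obtain ⟨r, hR, hrs, hsr⟩ : ∃ r : PowerSeries F, HasSubst r ∧ subst r s = X ∧ subst s r = X :=
    ⟨s.substInvOfIsUnit h1, HasSubst.substInvOfIsUnit s h1,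
      subst_substInvOfIsUnit_right s h0 h1, subst_substInvOfIsUnit_left s h0 h1⟩
  let φ : PowerSeries F ≃ₐ[F] PowerSeries F :=
    { substAlgHom (R := F) hS with
      toFun := fun f => subst s f
      invFun := fun f => subst r f
      map_mul' := fun f g => subst_mul hS f g
      map_add' := fun f g => subst_add hS f g
      commutes' := fun c => by
        have := (substAlgHom (R := F) hS).commutes c
        rwa [coe_substAlgHom] at this
      left_inv := fun f => by
        change subst r (subst s f) = f
        rw [subst_comp_subst_apply hS hR, hrs, X_subst]
      right_inv := fun f => by
        change subst s (subst r f) = f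
        rw [subst_comp_subst_apply hR hS, hsr, X_subst] }
  haveI := IsScalarTower.of_algebraMap_eq (R := F) (S := PowerSeries F) (A := LaurentSeries F)
    fun c => by
      change algebraMap F (LaurentSeries F) c = HahnSeries.ofPowerSeries ℤ F (C c)
      rw [HahnSeries.ofPowerSeries_C]
      rw [HahnSeries.algebraMap_apply', PowerSeries.algebraMap_apply]
      simp
  exact ⟨IsFractionRing.algEquivOfAlgEquiv φ, fun f => 
    IsFractionRing.algEquivOfAlgEquiv_algebraMap φ f⟩

/-- The result for power series. -/
lemma main (p : ℕ) [Fact (Nat.Prime p)] [CharP F p] [PerfectRing F p]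
    (a : PowerSeries F) (ha : ∀ b : PowerSeries F, b ^ p ≠ a) (n : ℕ) :
    ∃ N : ℕ, ∀ x : PowerSeries F, X ^ (N + 1) ∣ x - a →
      ∃ σ : LaurentSeries F ≃ₐ[F] LaurentSeries F,
        (∀ i : ℤ, i < (n : ℤ) →
          (σ (HahnSeries.single 1 1) - HahnSeries.single 1 1).coeff i = 0) ∧
        σ (algebraMap (PowerSeries F) (LaurentSeries F) a) =
          algebraMap (PowerSeries F) (LaurentSeries F) x := by
  have hd : derivative F a ≠ 0 := fun h => by
    obtain ⟨b, hb⟩ := pth_power p a h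
    exact ha b hb
  obtain ⟨d, e, he, hde⟩ : ∃ (d : ℕ) (e : PowerSeries F), IsUnit e ∧ derivative F a = X ^ d * e := by
    obtain ⟨d, u, hu⟩ := IsDiscreteValuationRing.eq_unit_mul_pow_irreducible hd X_irreducible
    exact ⟨d, u, u.isUnit, by rw [hu, mul_comm]⟩
  let k := d + 2 + n
  refine ⟨k + d, fun x hx => ?_⟩
  obtain ⟨s, hs, hsa⟩ := newton (k := k) (x := x) (by omega) he hde
    ((pow_dvd_pow X (Nat.le_succ _)).trans ((dvd_sub_comm).1 hx))
  obtain ⟨σ, hσ⟩ := exists_aut ((pow_dvd_pow X (by omega : 2 ≤ k)).trans hs)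
  refine ⟨σ, fun i hi => ?_, by rw [hσ, hsa]⟩
  have hX : (HahnSeries.single 1 1 : LaurentSeries F) =
      algebraMap (PowerSeries F) (LaurentSeries F) X := coe_X.symm
  rw [hX, hσ, subst_X (HasSubst.of_constantCoeff_zero' (hs_of_dvd (by omega) hs)), ← map_sub]
  change (HahnSeries.ofPowerSeries ℤ F (s - X)).coeff i = 0
  rw [coeff_coe]
  split_ifs with h
  · rfl
  · exact X_pow_dvd_iff.1 hs _ (by omega)

lemma lift_small {c : LaurentSeries F} {N : ℕ} (h : ∀ i : ℤ, i ≤ (N : ℤ) → c.coeff i = 0) :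
    ∃ y : PowerSeries F, c = algebraMap (PowerSeries F) (LaurentSeries F) (X ^ (N + 1) * y) := by
  refine ⟨mk fun i => c.coeff ((i + (N + 1) : ℕ) : ℤ), ?_⟩
  ext i
  change _ = (HahnSeries.ofPowerSeries ℤ F _).coeff i
  rw [coeff_coe, coeff_X_pow_mul']
  split_ifs with h1 h2
  · exact h i (by omega)
  · rw [coeff_mk]; congr 1; omega
  · exact h i (by omega)

end S7


/-- if `F` is perfect of characteristic `p > 0` and `a ∈ F((t))` is not a
`p`-th power, then for every `n` there is `N` such that the open ball
`B(N; a) = { x : v(x - a) > N }` is contained in the orbit of `a` under the group of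
`F`-automorphisms `σ` of `F((t))` with `v(σ(t) - t) ≥ n`. -/
theorem statement7 (F : Type*) [Field F] (p : ℕ) [Fact (Nat.Prime p)] [CharP F p]
    [PerfectRing F p]
    (a : LaurentSeries F) (ha : ∀ x : LaurentSeries F, x ^ p ≠ a) (n : ℕ) :
    ∃ N : ℕ, ∀ x : LaurentSeries F,
      (∀ i : ℤ, i ≤ (N : ℤ) → (x - a).coeff i = 0) →
      ∃ σ : LaurentSeries F ≃ₐ[F] LaurentSeries F,
        (∀ i : ℤ, i < (n : ℤ) →
          (σ (HahnSeries.single 1 1) - HahnSeries.single 1 1).coeff i = 0) ∧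
        σ a = x := by
  classical
  have hinj : Function.Injective (algebraMap (PowerSeries F) (LaurentSeries F)) :=
    IsFractionRing.injective _ _
  rcases ValuationRing.isInteger_or_isInteger (PowerSeries F) a with ⟨b, hb⟩ | ⟨b, hb⟩
  · subst hb
    obtain ⟨N, hN⟩ := S7.main p b (fun c hc => ha (algebraMap _ _ c) (by rw [← map_pow, hc])) n
    refine ⟨N, fun x hx => ?_⟩
    obtain ⟨y, hy⟩ := S7.lift_small hx
    obtain ⟨σ, h1, h2⟩ := hN (b + PowerSeries.X ^ (N + 1) * y) (by simp)
    refine ⟨σ, h1, ?_⟩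
    rw [h2, map_add, ← hy]; ring
  · have ha0 : a ≠ 0 := fun h => ha 0 (by
      rw [h, zero_pow (Fact.out : Nat.Prime p).ne_zero])
    have hba : a = (algebraMap (PowerSeries F) (LaurentSeries F) b)⁻¹ := by rw [hb, inv_inv]
    have hb0 : algebraMap (PowerSeries F) (LaurentSeries F) b ≠ 0 := by
      rw [hb]; exact inv_ne_zero ha0
    obtain ⟨N, hN⟩ := S7.main p b (fun c hc => ha (algebraMap _ _ c)⁻¹ (by
      rw [inv_pow, ← map_pow, hc, hba])) n
    refine ⟨N, fun x hx => ?_⟩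
    obtain ⟨y, hy⟩ := S7.lift_small hx
    have hu : IsUnit (1 + PowerSeries.X ^ (N + 1) * y * b) := by
      rw [PowerSeries.isUnit_iff_constantCoeff]; simp
    obtain ⟨u, hu⟩ := hu
    have huv : (u : PowerSeries F) * (u⁻¹ : (PowerSeries F)ˣ) = 1 := u.mul_inv
    obtain ⟨σ, h1, h2⟩ := hN (b * (u⁻¹ : (PowerSeries F)ˣ))
      ⟨- (y * b * b * (u⁻¹ : (PowerSeries F)ˣ)), by
        linear_combination b * huv - b * (u⁻¹ : (PowerSeries F)ˣ) * hu⟩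
    refine ⟨σ, h1, ?_⟩
    rw [hba, map_inv₀, h2]
    have hx' : x = (algebraMap (PowerSeries F) (LaurentSeries F) b)⁻¹ *
        algebraMap (PowerSeries F) (LaurentSeries F) u := by
      rw [hu, map_add, map_one, map_mul, ← hy, hba]
      field_simp
      ring
    have huv' := congrArg (algebraMap (PowerSeries F) (LaurentSeries F)) huv
    rw [map_mul, map_one] at huv'
    rw [hx', map_mul, mul_inv, inv_eq_of_mul_eq_one_left huv']
end

section
/- Let c ∈ F((t)) and N < ω. Then there exists n < ω such that for every uniformiser s with v(s - t) ≥ n, v(c ∘ s - c) > N; i.e. Orb_n(c) ⊆ B(N; c). -/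
open PowerSeries in
/-- Hensel: one-units of `F⟦X⟧` have `m`-th roots when `m` is invertible in `F`. -/
lemma aux_root_s10 (F : Type*) [Field F] (m : ℕ) (hm : (m : F) ≠ 0) (y : PowerSeries F) :
    ∃ z : PowerSeries F, z ^ m = 1 + X * y := by
  have hm0 : m ≠ 0 := by rintro rfl; simp at hm
  have hH : HenselianRing (PowerSeries F) (Ideal.span {(X : PowerSeries F)}) := inferInstance
  obtain ⟨a, ha, -⟩ := hH.is_henselian
    (Polynomial.X ^ m - Polynomial.C (1 + X * y)) (Polynomial.monic_X_pow_sub_C _ hm0) 1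
    (by
      simp only [Polynomial.eval_sub, Polynomial.eval_pow, Polynomial.eval_X, Polynomial.eval_C,
        one_pow]
      rw [Ideal.mem_span_singleton]
      exact ⟨-y, by ring⟩)
    (by
      apply IsUnit.map
      have : (Polynomial.derivative (Polynomial.X ^ m - Polynomial.C (1 + X * y))).eval 1
          = PowerSeries.C (m : F) := by
        rw [Polynomial.derivative_sub, Polynomial.derivative_X_pow, Polynomial.derivative_C]
        simp
      rw [this]
      exact (IsUnit.mk0 _ hm).map _)
  refine ⟨a, ?_⟩
  rw [Polynomial.IsRoot.def] at ha
  simpa [sub_eq_zero] using ha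

lemma aux_nonneg (F : Type*) [Field F] (y : PowerSeries F) :
    0 ≤ HahnSeries.addVal ℤ F (HahnSeries.ofPowerSeries ℤ F y) := by
  rw [HahnSeries.addVal_apply, HahnSeries.le_orderTop_iff_forall]
  intro j hj
  have hj' : j < 0 := by exact_mod_cast hj
  have := PowerSeries.coeff_coe y j
  rw [if_pos hj'] at this
  exact this

lemma aux_int (F : Type*) [Field F] (σ : LaurentSeries F ≃ₐ[F] LaurentSeries F)
    (y : PowerSeries F) :
    0 ≤ HahnSeries.addVal ℤ F (σ (HahnSeries.ofPowerSeries ℤ F (PowerSeries.X * y))) := by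
  set v := HahnSeries.addVal ℤ F with hv
  set w := σ (HahnSeries.ofPowerSeries ℤ F (PowerSeries.X * y)) with hw
  by_contra! hneg
  have hw0 : w ≠ 0 := by
    intro h
    rw [h] at hneg
    simp at hneg
  have h1 : v (1 + w) = v w := by
    apply AddValuation.map_add_eq_of_lt_right
    rw [AddValuation.map_one]; exact hneg
  have hvw : v w = (w.order : WithTop ℤ) := HahnSeries.addVal_apply_of_ne hw0
  have ho : w.order < 0 := by rw [hvw] at hneg; exact_mod_cast hneg
  obtain ⟨m, hm, hmF⟩ : ∃ m : ℕ, w.order.natAbs < m ∧ (m : F) ≠ 0 := by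
    by_cases h : ((w.order.natAbs + 1 : ℕ) : F) = 0
    · refine ⟨w.order.natAbs + 1 + 1, by omega, ?_⟩
      rw [Nat.cast_succ, h]; simp
    · exact ⟨_, by omega, h⟩
  obtain ⟨z, hz⟩ := aux_root_s10 F m hmF y
  have h2 : (σ (HahnSeries.ofPowerSeries ℤ F z)) ^ m = 1 + w := by
    rw [hw, ← map_pow, ← map_pow, hz, map_add, map_add, map_one, map_one]
  set Z := σ (HahnSeries.ofPowerSeries ℤ F z)
  have h3 : m • v Z = (w.order : WithTop ℤ) := by
    rw [← AddValuation.map_pow, h2, h1, hvw]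
  have hZ : Z ≠ 0 := by
    intro h
    rw [h, zero_pow (by omega)] at h2
    rw [← h2] at h1
    rw [hvw] at h1
    simp at h1
  rw [hv, HahnSeries.addVal_apply_of_ne hZ] at h3
  have h4 : (m : ℤ) * Z.order = w.order := by
    rw [← nsmul_eq_mul]
    exact_mod_cast h3
  have h5 : (m : ℤ) ∣ w.order := ⟨_, h4.symm⟩
  have := Int.natAbs_le_of_dvd_ne_zero h5 (by omega)
  simp at this
  omega

lemma aux_alg (F : Type*) [Field F] (σ : LaurentSeries F ≃ₐ[F] LaurentSeries F) (a : F) :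
    σ (HahnSeries.ofPowerSeries ℤ F (PowerSeries.C a)) =
      HahnSeries.ofPowerSeries ℤ F (PowerSeries.C a) := by
  rw [HahnSeries.ofPowerSeries_C, ← LaurentSeries.algebraMap_apply]
  exact σ.commutes a

lemma aux_int' (F : Type*) [Field F] (σ : LaurentSeries F ≃ₐ[F] LaurentSeries F)
    (y : PowerSeries F) :
    0 ≤ HahnSeries.addVal ℤ F (σ (HahnSeries.ofPowerSeries ℤ F y)) := by
  rw [PowerSeries.eq_X_mul_shift_add_const y, map_add, map_add, aux_alg]
  exact AddValuation.map_le_add _ (aux_int F σ _) (aux_nonneg F _)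

lemma aux_ps (F : Type*) [Field F] (σ : LaurentSeries F ≃ₐ[F] LaurentSeries F) (n : ℕ)
    (h : (n : WithTop ℤ) ≤ HahnSeries.addVal ℤ F
      (σ (HahnSeries.single 1 1) - HahnSeries.single 1 1)) (K : ℕ) (hK : K ≤ n) :
    ∀ d : PowerSeries F, (K : WithTop ℤ) ≤ HahnSeries.addVal ℤ F
      (σ (HahnSeries.ofPowerSeries ℤ F d) - HahnSeries.ofPowerSeries ℤ F d) := by
  induction K with
  | zero =>
    intro d
    exact_mod_cast AddValuation.map_le_sub _ (aux_int' F σ d) (aux_nonneg F d)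
  | succ K ih =>
    intro d
    obtain ⟨e, a, rfl⟩ : ∃ e a, d = PowerSeries.X * e + PowerSeries.C a :=
      ⟨_, _, PowerSeries.eq_X_mul_shift_add_const d⟩
    have key : σ (HahnSeries.ofPowerSeries ℤ F (PowerSeries.X * e + PowerSeries.C a)) -
        HahnSeries.ofPowerSeries ℤ F (PowerSeries.X * e + PowerSeries.C a) =
        (σ (HahnSeries.single 1 1) - HahnSeries.single 1 1) * σ (HahnSeries.ofPowerSeries ℤ F e)
        + HahnSeries.single 1 1 *
          (σ (HahnSeries.ofPowerSeries ℤ F e) - HahnSeries.ofPowerSeries ℤ F e) := by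
      simp only [map_add, map_mul, aux_alg, HahnSeries.ofPowerSeries_X]
      ring
    rw [key]
    apply AddValuation.map_le_add
    · rw [AddValuation.map_mul]
      calc ((K + 1 : ℕ) : WithTop ℤ) ≤ (n : WithTop ℤ) + 0 := by
            rw [add_zero]; exact_mod_cast hK
        _ ≤ _ := add_le_add h (aux_int' F σ e)
    · rw [AddValuation.map_mul]
      have h1 : HahnSeries.addVal ℤ F (HahnSeries.single 1 1) = (1 : WithTop ℤ) := by
        rw [HahnSeries.addVal_apply, HahnSeries.orderTop_single one_ne_zero]; rfl
      rw [h1, Nat.cast_succ, add_comm]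
      exact add_le_add le_rfl (ih (by omega) e)

/-- continuity of the substitution action: for `c ∈ F((t))` and `N < ω`
there is `n < ω` such that every `F`-automorphism `σ` with `v(σ(t) - t) ≥ n` satisfies
`v(σ(c) - c) > N`; i.e. `Orb_n(c) ⊆ B(N; c)`. -/
theorem statement10 (F : Type*) [Field F] (c : LaurentSeries F) (N : ℕ) :
    ∃ n : ℕ, ∀ σ : LaurentSeries F ≃ₐ[F] LaurentSeries F,
      (∀ i : ℤ, i < (n : ℤ) →
        (σ (HahnSeries.single 1 1) - HahnSeries.single 1 1).coeff i = 0) →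
      ∀ i : ℤ, i ≤ (N : ℤ) → (σ c - c).coeff i = 0 := by
  obtain ⟨⟨d, s⟩, hs⟩ := IsLocalization.surj (Submonoid.powers (PowerSeries.X : PowerSeries F)) c
  obtain ⟨_, m, rfl⟩ := s
  simp only [LaurentSeries.coe_algebraMap, map_pow, HahnSeries.ofPowerSeries_X] at hs
  refine ⟨N + 2 * m + 2, fun σ hσ i hi => ?_⟩
  set t : LaurentSeries F := HahnSeries.single 1 1 with ht
  set v := HahnSeries.addVal ℤ F with hv
  have h : ((N + 2 * m + 2 : ℕ) : WithTop ℤ) ≤ v (σ t - t) := by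
    rw [hv, HahnSeries.addVal_apply, HahnSeries.le_orderTop_iff_forall]
    intro j hj
    exact hσ j (WithTop.coe_lt_coe.1 hj)
  have h1 : v t = (1 : WithTop ℤ) := by
    rw [hv, HahnSeries.addVal_apply, HahnSeries.orderTop_single one_ne_zero]; rfl
  have hT : v (σ t) = 1 := by
    have : v (t + (σ t - t)) = v t := by
      apply AddValuation.map_add_eq_of_lt_left
      rw [h1]
      refine lt_of_lt_of_le ?_ h
      have : 1 < N + 2 * m + 2 := by omega
      exact_mod_cast this
    rw [← h1, ← this]; congr 1; ring
  have hps := aux_ps F σ _ h _ le_rfl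
  have hd := hps d
  have hX := hps (PowerSeries.X ^ m)
  simp only [map_pow, HahnSeries.ofPowerSeries_X] at hX
  rw [← hs, map_mul, map_pow] at hd
  have hd0 : 0 ≤ v (c * t ^ m) := by rw [hs]; exact aux_nonneg F d
  have key : (σ t) ^ m * t ^ m * (σ c - c) =
      t ^ m * (σ c * σ t ^ m - c * t ^ m) - (σ t ^ m - t ^ m) * (c * t ^ m) := by ring
  have hk : ((N + 2 * m + 2 : ℕ) : WithTop ℤ) ≤ v ((σ t) ^ m * t ^ m * (σ c - c)) := by
    rw [key]
    apply AddValuation.map_le_sub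
    · rw [AddValuation.map_mul, AddValuation.map_pow, h1, ← zero_add (((N + 2 * m + 2 : ℕ)) : WithTop ℤ)]
      refine add_le_add ?_ hd
      simp
    · rw [AddValuation.map_mul, ← add_zero (((N + 2 * m + 2 : ℕ)) : WithTop ℤ)]
      exact add_le_add hX hd0
  by_cases hw : σ c - c = 0
  · rw [hw]; simp
  rw [AddValuation.map_mul, AddValuation.map_mul, AddValuation.map_pow, AddValuation.map_pow,
    h1, hT, hv, HahnSeries.addVal_apply_of_ne hw] at hk
  have hk' : ((N + 2 * m + 2 : ℕ) : ℤ) ≤ m • (1 : ℤ) + m • (1 : ℤ) + (σ c - c).order := by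
    rw [← WithTop.coe_le_coe, WithTop.coe_add, WithTop.coe_add, WithTop.coe_nsmul]
    exact hk
  simp at hk'
  apply HahnSeries.coeff_eq_zero_of_lt_order
  omega
end

section
/- Let F be a perfect field and a a tuple from F((t)) of transcendence degree 1 over F. Then the orbit Orb(a) of a under F-automorphisms of F((t)) equals locus(a) ∩ U ∩ P_l, where U = ∪_{σ ∈ G} B(N; σ(a)) for suitable N and P_l = { (y, z) : y ∈ F((t))^{p^l} } for suitable l; in particular Orb(a) is the intersection of a Zariski-closed F-definable set, an open set, and the set of tuples whose distinguished coordinate is a p^l-th power. -/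
namespace S15
open PowerSeries
variable {F : Type*} [Field F]


/-- fixed point of contraction -/
lemma fixed (Φ : F⟦X⟧ → F⟦X⟧)
    (h : ∀ (n : ℕ) (z w : F⟦X⟧), X ^ n ∣ z - w → X ^ (n+1) ∣ Φ z - Φ w) : ∃ z, Φ z = z := by
  have h1 : ∀ n, X ^ n ∣ Φ^[n+1] 0 - Φ^[n] 0 := by
    intro n
    induction n with
    | zero => simp
    | succ n ih =>
      rw [Function.iterate_succ_apply', Function.iterate_succ_apply' Φ n] at *
      exact h _ _ _ ih
  have h2 : ∀ n k, X ^ n ∣ Φ^[n+k] 0 - Φ^[n] 0 := by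
    intro n k
    induction k with
    | zero => simp
    | succ k ih =>
      have := (pow_dvd_pow X (Nat.le_add_right n k)).trans (h1 (n+k))
      have := dvd_add this ih
      simpa [← add_assoc] using this
  let z : F⟦X⟧ := PowerSeries.mk fun n => coeff n (Φ^[n+1] 0)
  have h3 : ∀ n, X ^ n ∣ z - Φ^[n] 0 := by
    intro n
    rw [X_pow_dvd_iff]
    intro m hm
    obtain ⟨k, rfl⟩ := Nat.exists_eq_add_of_le (Nat.succ_le_of_lt hm)
    have := h2 (m+1) k
    rw [X_pow_dvd_iff] at this
    have := this m (by omega)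
    simp only [map_sub, z, coeff_mk] at this ⊢
    rw [sub_eq_zero] at this ⊢
    exact this.symm
  refine ⟨z, ?_⟩
  ext n
  have a1 := h n _ _ (h3 n)
  have a2 := h3 (n+1)
  rw [← Function.iterate_succ_apply' Φ] at a1
  have := dvd_sub a1 a2
  rw [X_pow_dvd_iff] at this
  have := this n (by omega)
  simpa [sub_eq_zero] using this

lemma solve (H : F⟦X⟧ → F⟦X⟧) (β : F⟦X⟧) (hβ : IsUnit β) (c : ℕ) (h0 : X ^ c ∣ H 0)
    (h : ∀ (n : ℕ) (z w : F⟦X⟧), X ^ n ∣ z - w →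
      X ^ (c + 1 + n) ∣ H z - H w - X ^ c * β * (z - w)) : ∃ z, H z = 0 := by
  have h1 : ∀ z, X ^ c ∣ H z := by
    intro z
    have a := h 0 z 0 (by simp)
    have a' := (pow_dvd_pow X (show c ≤ c + 1 + 0 by omega)).trans a
    have : H z = (H z - H 0 - X^c * β * (z-0)) + H 0 + X^c * (β * (z-0)) := by ring
    rw [this]
    exact dvd_add (dvd_add a' h0) (dvd_mul_right _ _)
  choose K hK using h1
  obtain ⟨γ, hγ⟩ := hβ.exists_left_inv
  obtain ⟨z, hz⟩ := fixed (fun z => z - γ * K z) (by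
    intro n z w hzw
    have a := h n z w hzw
    rw [hK, hK, show X ^ c * K z - X^c * K w - X^c * β * (z-w) =
      X^c * (K z - K w - β * (z-w)) by ring, show c + 1 + n = c + (n+1) by omega, pow_add X c] at a
    have a := (mul_dvd_mul_iff_left (pow_ne_zero _ X_ne_zero)).1 a
    have : z - γ * K z - (w - γ * K w) = - γ * (K z - K w - β * (z-w)) := by
      linear_combination (w - z) * hγ
    rw [this]
    exact a.mul_left _)
  refine ⟨z, ?_⟩
  have : γ * K z = 0 := by linear_combination -hz
  have : K z = 0 := by linear_combination β * this - K z * hγ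
  rw [hK, this, mul_zero]

lemma poly_hom (φ : F⟦X⟧ →ₐ[F] F⟦X⟧) (P : Polynomial F) :
    φ (P : F⟦X⟧) = ((P.map (algebraMap F F⟦X⟧)).eval (φ X)) := by
  rw [Polynomial.eval_map_algebraMap]
  induction P using Polynomial.induction_on' with
  | add p q hp hq => simp [hp, hq]
  | monomial n a => 
    simp only [Polynomial.coe_monomial, Polynomial.aeval_monomial]
    rw [monomial_eq_C_mul_X_pow, map_mul, map_pow]
    congr 1
    exact φ.commutes a

lemma hom_dvd (φ : F⟦X⟧ →ₐ[F] F⟦X⟧) (hφ : X ∣ φ X) (n : ℕ) (f : F⟦X⟧) (hf : X ^ n ∣ f) :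
    X ^ n ∣ φ f := by
  obtain ⟨r, rfl⟩ := hf
  rw [map_mul, map_pow]
  exact (pow_dvd_pow_of_dvd hφ n).mul_right _

lemma taylor1 (φ ψ : F⟦X⟧ →ₐ[F] F⟦X⟧) (hφ : X ∣ φ X) (hψ : X ∣ ψ X) (k : ℕ)
    (h : X ^ k ∣ φ X - ψ X) (b : F⟦X⟧) : X ^ k ∣ φ b - ψ b := by
  rw [eq_X_pow_mul_shift_add_trunc k b]
  set r := (mk fun i ↦ coeff (i + k) b)
  rw [map_add, map_add, poly_hom, poly_hom]
  have a1 := hom_dvd φ hφ k (X^k * r) (dvd_mul_right _ _)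
  have a2 := hom_dvd ψ hψ k (X^k * r) (dvd_mul_right _ _)
  have a3 := h.trans (Polynomial.sub_dvd_eval_sub (φ X) (ψ X) ((b.trunc k).map (algebraMap F F⟦X⟧)))
  have := dvd_add (dvd_sub a1 a2) a3
  convert this using 1
  ring

lemma taylor2 (φ ψ : F⟦X⟧ →ₐ[F] F⟦X⟧) (hφ : X ∣ φ X) (hψ : X ∣ ψ X) (k : ℕ)
    (h : X ^ k ∣ φ X - ψ X) (b : F⟦X⟧) :
    X ^ (2 * k) ∣ φ b - ψ b - ψ (d⁄dX F b) * (φ X - ψ X) := by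
  rw [eq_X_pow_mul_shift_add_trunc (2*k+1) b]
  set r := (mk fun i ↦ coeff (i + (2*k+1)) b)
  set P := b.trunc (2*k+1)
  have a1 := hom_dvd φ hφ (2*k) (X^(2*k+1) * r) ((pow_dvd_pow X (by omega)).mul_right _)
  have a2 := hom_dvd ψ hψ (2*k) (X^(2*k+1) * r) ((pow_dvd_pow X (by omega)).mul_right _)
  have a3 := hom_dvd ψ hψ (2*k) (d⁄dX F (X^(2*k+1) * r)) (by
    rw [Derivation.leibniz, derivative_pow]
    simp only [smul_eq_mul, derivative_X, Nat.add_sub_cancel]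
    refine dvd_add ((pow_dvd_pow X (by omega)).mul_right _) ?_
    refine Dvd.dvd.mul_left ?_ _
    rw [mul_one]
    exact dvd_mul_left _ _)
  obtain ⟨q, hq⟩ := Polynomial.binomExpansion (P.map (algebraMap F F⟦X⟧)) (ψ X) (φ X - ψ X)
  rw [add_sub_cancel, Polynomial.derivative_map, ← poly_hom, ← poly_hom, ← poly_hom, ← derivative_coe] at hq
  simp only [map_add, hq]
  have a4 : X^(2*k) ∣ q * (φ X - ψ X)^2 := by
    rw [mul_comm 2 k, pow_mul]
    exact (pow_dvd_pow_of_dvd h 2).mul_left _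
  have := dvd_add (dvd_sub (dvd_sub a1 a2) (a3.mul_right (φ X - ψ X))) a4
  convert this using 1
  ring

noncomputable abbrev emb (F : Type*) [Field F] : F⟦X⟧ →+* LaurentSeries F := HahnSeries.ofPowerSeries ℤ F

lemma emb_C (r : F) : emb F (C r) = algebraMap F (LaurentSeries F) r := rfl

lemma tower : @IsScalarTower F F⟦X⟧ (LaurentSeries F) Algebra.toSMul Algebra.toSMul Algebra.toSMul :=
  IsScalarTower.of_algebraMap_eq (fun _ => rfl)

lemma le_emb (g : F⟦X⟧) (n : ℕ) : ((n : ℤ) : WithTop ℤ) ≤ (emb F g).orderTop ↔ X ^ n ∣ g := by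
  rw [HahnSeries.le_orderTop_iff_forall, X_pow_dvd_iff]
  constructor
  · intro h m hm
    have := h m (by exact_mod_cast hm)
    rwa [LaurentSeries.coeff_coe_powerSeries] at this
  · intro h j hj
    have hj : j < n := by exact_mod_cast hj
    rw [PowerSeries.coeff_coe]
    split_ifs with h0
    · rfl
    · exact h _ (by omega)

lemma exists_emb (f : LaurentSeries F) (hf : 0 ≤ f.orderTop) : ∃ g, emb F g = f := by
  by_cases h0 : f = 0
  · exact ⟨0, by simp [h0]⟩
  have h : 0 ≤ f.order := HahnSeries.zero_le_orderTop_iff.1 hf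
  obtain ⟨n, hn⟩ := Int.eq_ofNat_of_zero_le h
  refine ⟨X ^ n * f.powerSeriesPart, ?_⟩
  rw [LaurentSeries.X_order_mul_powerSeriesPart hn.symm]

lemma exists_unit (f : LaurentSeries F) (hf : f ≠ 0) :
    ∃ u : F⟦X⟧, IsUnit u ∧ f = (emb F X) ^ f.order * emb F u := by
  refine ⟨f.powerSeriesPart, ?_, ?_⟩
  · rw [isUnit_iff_constantCoeff, ← coeff_zero_eq_constantCoeff_apply, LaurentSeries.powerSeriesPart_coeff,
      isUnit_iff_ne_zero]
    simpa using hf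
  · conv_lhs => rw [← LaurentSeries.single_order_mul_powerSeriesPart f]
    rw [PowerSeries.coe_X, ← RatFunc.single_zpow]

lemma root1 (n : ℕ) (hn : (n : F) ≠ 0) (f : F⟦X⟧) : ∃ z : F⟦X⟧, (1 + X * z) ^ n = 1 + X * f := by
  obtain ⟨z, hz⟩ := solve (fun z => (1 + X * z) ^ n - (1 + X * f)) (C (n : F))
    ((isUnit_iff_ne_zero.2 hn).map C) 1 (by
      refine ⟨- f, ?_⟩
      simp only [mul_zero, add_zero, one_pow]; ring) (by
      intro k z w hzw
      obtain ⟨q, hq⟩ := Polynomial.binomExpansion (Polynomial.X ^ n : Polynomial F⟦X⟧) (1 + X * w) (X * (z - w))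
      obtain ⟨q', hq'⟩ := Polynomial.evalSubFactor (Polynomial.X ^ (n-1) : Polynomial F⟦X⟧) (1 + X * w) 1
      simp only [Polynomial.eval_pow, Polynomial.eval_X, Polynomial.derivative_X_pow,
        Polynomial.eval_mul, Polynomial.eval_C, one_pow] at hq hq'
      obtain ⟨r, hr⟩ := hzw
      have hcn : (C (n : F)) = (n : F⟦X⟧) := by simp
      rw [hcn]
      have e1 : (1 + X * w) + X * (z - w) = 1 + X * z := by ring
      rw [e1] at hq
      simp only [hq]
      have e2 : (1 + X * w : F⟦X⟧) ^ (n-1) = 1 + q' * (X * w) := by linear_combination hq'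
      rw [e2, hr]
      refine ⟨(n : F⟦X⟧) * q' * w * r + q * r ^ 2 * X ^ k, ?_⟩
      ring)
  exact ⟨z, sub_eq_zero.1 hz⟩

lemma root (n : ℕ) (hn : (n : F) ≠ 0) (k : ℕ) (f : F⟦X⟧) :
    ∃ z : F⟦X⟧, (1 + X * z) ^ (n ^ k) = 1 + X * f := by
  induction k generalizing f with
  | zero => exact ⟨f, by simp⟩
  | succ k ih =>
    obtain ⟨z, hz⟩ := root1 n hn f
    obtain ⟨w, hw⟩ := ih z
    exact ⟨w, by rw [pow_succ, pow_mul, hw, hz]⟩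

lemma emb_inj : Function.Injective (emb F) := HahnSeries.ofPowerSeries_injective

lemma order_zpow' (f : LaurentSeries F) (hf : f ≠ 0) (k : ℤ) : (f ^ k).order = k * f.order := by
  have hnat : ∀ n : ℕ, (f ^ n).order = n * f.order := by
    intro n; rw [HahnSeries.order_pow]; simp
  obtain ⟨n, rfl | rfl⟩ := k.eq_nat_or_neg
  · rw [zpow_natCast, hnat]
  · rw [zpow_neg, zpow_natCast]
    have : ((f ^ n) * (f^n)⁻¹).order = 0 := by
      rw [mul_inv_cancel₀ (pow_ne_zero _ hf)]; exact HahnSeries.order_one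
    rw [HahnSeries.order_mul (pow_ne_zero _ hf) (inv_ne_zero (pow_ne_zero _ hf)), hnat] at this
    linarith

lemma order_unit (n : ℕ) (hn : (n : F) ≠ 0) (hn2 : 2 ≤ n) (σ : LaurentSeries F ≃ₐ[F] LaurentSeries F)
    (u : F⟦X⟧) (hu : IsUnit u) : (σ (emb F u)).order = 0 := by
  rw [isUnit_iff_constantCoeff, isUnit_iff_ne_zero] at hu
  set c := constantCoeff u
  obtain ⟨f, hf⟩ : ∃ f, u = C c * (1 + X * f) := by
    have : X ∣ C c⁻¹ * u - 1 := by
      rw [X_dvd_iff]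
      simp [c, inv_mul_cancel₀ hu]
    obtain ⟨f, hf⟩ := this
    refine ⟨f, ?_⟩
    have : C c * C c⁻¹ = (1 : F⟦X⟧) := by rw [← map_mul, mul_inv_cancel₀ hu, map_one]
    linear_combination C c * hf - u * this
  have key : ∀ k : ℕ, ((n : ℤ) ^ k) ∣ (σ (emb F u)).order := by
    intro k
    obtain ⟨z, hz⟩ := root n hn k f
    have hz0 : (1 + X * z : F⟦X⟧) ≠ 0 := by
      intro h
      have := congrArg constantCoeff h
      simp at this
    rw [hf, ← hz, map_mul, map_mul, emb_C, AlgEquiv.commutes, map_pow, map_pow, HahnSeries.order_mul, HahnSeries.order_pow]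
    · have : (algebraMap F (LaurentSeries F) c).order = 0 := by
        rw [← emb_C, PowerSeries.coe_C, HahnSeries.order_C]
      rw [this]
      simp
    · simpa using hu
    · refine pow_ne_zero _ ?_
      rw [map_ne_zero_iff _ σ.injective, map_ne_zero_iff _ emb_inj]
      exact hz0
  by_contra h
  have h1 := Int.le_of_dvd (abs_pos.2 h) ((dvd_abs _ _).2 (key (σ (emb F u)).order.natAbs))
  have h2 := Nat.lt_pow_self (n := (σ (emb F u)).order.natAbs) (a := n) (by omega)
  have h3 : ((σ (emb F u)).order.natAbs : ℤ) < (n:ℤ) ^ (σ (emb F u)).order.natAbs := by exact_mod_cast h2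
  rw [Int.abs_eq_natAbs] at h1
  omega

lemma preserve (n : ℕ) (hn : (n : F) ≠ 0) (hn2 : 2 ≤ n) (σ : LaurentSeries F ≃ₐ[F] LaurentSeries F)
    (f : LaurentSeries F) : (σ f).orderTop = f.orderTop := by
  have hX0 : emb F X ≠ 0 := by rw [map_ne_zero_iff _ emb_inj]; exact X_ne_zero
  have h1 : ∀ (σ : LaurentSeries F ≃ₐ[F] LaurentSeries F) (f : LaurentSeries F), f ≠ 0 →
      (σ f).order = f.order * (σ (emb F X)).order := by
    intro σ f hf
    obtain ⟨u, hu, hfu⟩ := exists_unit f hf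
    have hX : σ (emb F X) ≠ 0 := by rwa [map_ne_zero_iff _ σ.injective]
    conv_lhs => rw [hfu]
    rw [map_mul, map_zpow₀, HahnSeries.order_mul (zpow_ne_zero _ hX), order_zpow' _ hX,
      order_unit n hn hn2 σ u hu, add_zero]
    rw [map_ne_zero_iff _ σ.injective, map_ne_zero_iff _ emb_inj]
    exact hu.ne_zero
  have hX1 : (emb F X).order = 1 := by
    rw [PowerSeries.coe_X]; exact HahnSeries.order_single one_ne_zero
  have h2 : (σ (emb F X)).order = 1 := by
    have a := h1 σ (σ.symm (emb F X)) (by rwa [map_ne_zero_iff _ σ.symm.injective])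
    rw [AlgEquiv.apply_symm_apply, hX1] at a
    rcases Int.eq_one_or_neg_one_of_mul_eq_one' a.symm with h | h
    · exact h.2
    · exfalso
      have h' := h.2
      have hu : IsUnit (1 + X : F⟦X⟧) := by
        rw [isUnit_iff_constantCoeff]; simp
      have b := order_unit n hn hn2 σ _ hu
      have c : 0 ≤ (σ (emb F (1 + X))).orderTop := HahnSeries.zero_le_orderTop_iff.2 b.ge
      have d : 0 ≤ (1 : LaurentSeries F).orderTop := HahnSeries.zero_le_orderTop_iff.2 (by simp)
      have e : 0 ≤ (σ (emb F (1+X)) - 1).orderTop := (le_min c d).trans HahnSeries.min_orderTop_le_orderTop_sub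
      rw [map_add, map_one, map_add, map_one, add_sub_cancel_left, HahnSeries.zero_le_orderTop_iff, h'] at e
      omega
  by_cases hf : f = 0
  · simp [hf]
  · have hσ : σ f ≠ 0 := by rwa [map_ne_zero_iff _ σ.injective]
    rw [← HahnSeries.order_eq_orderTop_of_ne_zero hf, ← HahnSeries.order_eq_orderTop_of_ne_zero hσ, h1 σ f hf, h2, mul_one]

/-- the substitution homomorphism -/
noncomputable def sub (M : ℕ) (hM : M ≠ 0) (z : F⟦X⟧) : F⟦X⟧ →ₐ[F] F⟦X⟧ :=
  substAlgHom (R := F) (S := F) (a := (X + X ^ M * z : F⟦X⟧)) (HasSubst.of_constantCoeff_zero' (by simp [hM]))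

lemma sub_X (M : ℕ) (hM : M ≠ 0) (z : F⟦X⟧) : sub M hM z X = X + X ^ M * z :=
  substAlgHom_X _

lemma dvd_sub_X (M : ℕ) (hM : M ≠ 0) (z : F⟦X⟧) : X ∣ sub M hM z X := by
  rw [sub_X]
  exact dvd_add dvd_rfl ((dvd_pow_self X hM).mul_right _)

lemma sub_bij (M : ℕ) (hM : 2 ≤ M) (z : F⟦X⟧) : Function.Bijective (sub M (by omega) z) := by
  set s : F⟦X⟧ := X + X ^ M * z with hs
  have h0 : constantCoeff s = 0 := by simp [hs, show M ≠ 0 by omega]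
  have h1 : IsUnit (coeff 1 s) := by
    rw [isUnit_iff_ne_zero]
    simp [hs, coeff_X_pow_mul', show ¬ (M ≤ 1) by omega]
  have hs1 : HasSubst s := HasSubst.of_constantCoeff_zero' h0
  have hs2 : HasSubst (s.substInvOfIsUnit h1) := HasSubst.of_constantCoeff_zero' (by simp)
  have e : ∀ f, sub M (by omega) z f = f.subst s := by
    intro f
    rw [sub, coe_substAlgHom]
  constructor
  · intro f g hfg
    rw [e, e] at hfg
    have := congrArg (fun h => subst (s.substInvOfIsUnit h1) h) hfg
    simpa only [subst_comp_subst_apply hs1 hs2, subst_substInvOfIsUnit_right s h0 h1, X_subst] using this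
  · intro f
    refine ⟨f.subst (s.substInvOfIsUnit h1), ?_⟩
    rw [e, subst_comp_subst_apply hs2 hs1, subst_substInvOfIsUnit_left s h0 h1, X_subst]

lemma exists_aut (M : ℕ) (hM : 2 ≤ M) (z : F⟦X⟧) : ∃ τ : LaurentSeries F ≃ₐ[F] LaurentSeries F,
    ∀ g, τ (emb F g) = emb F (sub M (by omega) z g) := by
  have := tower (F := F)
  let h := AlgEquiv.ofBijective (sub M (by omega) z) (sub_bij M hM z)
  refine ⟨IsFractionRing.algEquivOfAlgEquiv h, fun g => ?_⟩
  exact IsFractionRing.algEquivOfAlgEquiv_algebraMap h g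

lemma newton (b y β : F⟦X⟧) (e M : ℕ) (hβ : IsUnit β) (hb : d⁄dX F b = X ^ e * β) (hM : e + 2 ≤ M)
    (hy : X ^ (M + e) ∣ b - y) : ∃ z, sub M (by omega) z b = y := by
  have hM0 : M ≠ 0 := by omega
  have hid : sub M hM0 (0 : F⟦X⟧) = AlgHom.id F _ := by
    ext1 f
    rw [sub, coe_substAlgHom]
    simp [X_subst]
  obtain ⟨z, hz⟩ := solve (fun z => sub M hM0 z b - y) β hβ (M+e) (by
    simp only [hid]; exact hy) (by
    intro n z w hzw
    have hd : sub M hM0 z X - sub M hM0 w X = X ^ M * (z - w) := by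
      rw [sub_X, sub_X]; ring
    have hk : X ^ (M + n) ∣ sub M hM0 z X - sub M hM0 w X := by
      rw [hd, pow_add]
      exact mul_dvd_mul dvd_rfl hzw
    have t2 := taylor2 _ _ (dvd_sub_X M hM0 z) (dvd_sub_X M hM0 w) _ hk b
    have t1 := taylor1 (sub M hM0 w) (AlgHom.id F _) (dvd_sub_X M hM0 w) (by simp) M
      (by rw [sub_X]; simp) (d⁄dX F b)
    rw [hd] at t2
    have t3 : X ^ (M + e + 1 + n) ∣ (sub M hM0 w (d⁄dX F b) - d⁄dX F b) * (X ^ M * (z - w)) := by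
      refine dvd_trans ?_ (mul_dvd_mul t1 (mul_dvd_mul (dvd_refl (X ^ M)) hzw))
      rw [← pow_add, ← pow_add]
      exact pow_dvd_pow _ (by omega)
    have t4 := (pow_dvd_pow (X : F⟦X⟧) (show M + e + 1 + n ≤ 2 * (M + n) by omega)).trans t2
    have := dvd_add t4 t3
    convert this using 1
    rw [hb]
    ring)
  exact ⟨z, sub_eq_zero.1 hz⟩

lemma emb_X_orderTop (d : ℕ) : ((emb F X) ^ d).orderTop = ((d : ℤ) : WithTop ℤ) := by
  rw [← map_pow]
  apply le_antisymm
  · by_contra! h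
    have h' : (((d + 1 : ℕ) : ℤ) : WithTop ℤ) ≤ (emb F (X ^ d)).orderTop := by
      rw [HahnSeries.le_orderTop_iff_forall]
      intro j hj
      apply HahnSeries.coeff_eq_zero_of_lt_orderTop
      refine lt_of_le_of_lt ?_ h
      have : j < ((d+1 : ℕ) : ℤ) := by exact_mod_cast hj
      have : j ≤ d := by push_cast at this; omega
      exact_mod_cast this
    rw [le_emb, X_pow_dvd_iff] at h'
    have := h' d (by omega)
    simp [coeff_X_pow] at this
  · rw [le_emb]

lemma close (n : ℕ) (hn : (n : F) ≠ 0) (hn2 : 2 ≤ n) (f : LaurentSeries F) :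
    ∃ d : ℕ, ∀ (M : ℕ) (hM : M ≠ 0) (z : F⟦X⟧)
    (τ : LaurentSeries F ≃ₐ[F] LaurentSeries F), (∀ g, τ (emb F g) = emb F (sub M hM z g)) →
    ((M : ℤ) : WithTop ℤ) ≤ (τ f - f).orderTop + ((d : ℤ) : WithTop ℤ) := by
  obtain ⟨d, h, hd⟩ : ∃ (d : ℕ) (h : F⟦X⟧), f * (emb F X) ^ d = emb F h := by
    by_cases h0 : f = 0
    · exact ⟨0, 0, by simp [h0]⟩
    obtain ⟨u, hu, hfu⟩ := exists_unit f h0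
    have hX0 : emb F X ≠ 0 := by rw [map_ne_zero_iff _ emb_inj]; exact X_ne_zero
    obtain ⟨k, hk⟩ := Int.eq_ofNat_of_zero_le (show 0 ≤ f.order + f.order.natAbs by omega)
    refine ⟨f.order.natAbs, X ^ k * u, ?_⟩
    rw [map_mul, map_pow, ← zpow_natCast _ k, ← hk, zpow_add₀ hX0, zpow_natCast]
    linear_combination (emb F X ^ f.order.natAbs) * hfu
  refine ⟨d + d, ?_⟩
  intro M hM z τ hτ
  have e1 : (τ f - f) * ((emb F X) ^ d * τ ((emb F X) ^ d)) =
      emb F (X ^ d * (sub M hM z h - h) - (sub M hM z (X ^ d) - X ^ d) * h) := by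
    have : τ f * τ ((emb F X) ^ d) = emb F (sub M hM z h) := by rw [← map_mul, hd, hτ]
    simp only [map_sub, map_mul]
    rw [← hτ (X ^ d), ← this, ← hd]
    simp only [map_pow]
    ring
  have e2 : ∀ g, X ^ M ∣ sub M hM z g - g := by
    intro g
    have := taylor1 (sub M hM z) (AlgHom.id F _) (dvd_sub_X M hM z) (by simp) M
      (by rw [sub_X]; simp) g
    simpa using this
  have e3 := (le_emb _ M).2 (dvd_sub ((e2 h).mul_left (X ^ d)) ((e2 (X^d)).mul_right h))
  rw [← e1, HahnSeries.orderTop_mul, HahnSeries.orderTop_mul, preserve n hn hn2, emb_X_orderTop] at e3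
  convert e3 using 2
  push_cast
  rfl

lemma pth (p : ℕ) [ExpChar F p] [PerfectRing F p] (k : ℕ) (hk : k ≠ 0) (g : F⟦X⟧) (hg : coeff k g ≠ 0) :
    ∃ (l : ℕ) (h : F⟦X⟧), h ^ (p ^ l) = g ∧ d⁄dX F h ≠ 0 := by
  induction k using Nat.strong_induction_on generalizing g with
  | _ k ih =>
  by_cases hd : d⁄dX F g = 0
  · have hc : ∀ n : ℕ, n ≠ 0 → coeff n g * (n : F) = 0 := by
      intro n hn
      obtain ⟨n, rfl⟩ := Nat.exists_eq_succ_of_ne_zero hn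
      have := congrArg (coeff n) hd
      rw [coeff_derivative] at this
      simpa using this
    have hkF : (k : F) = 0 := (mul_eq_zero.1 (hc k hk)).resolve_left hg
    rcases ‹ExpChar F p› with _ | hp
    · exact absurd (Nat.cast_eq_zero.1 hkF) hk
    rename_i hchar
    have hp0 : p ≠ 0 := hp.ne_zero
    have hExp : ExpChar F p := ExpChar.prime hp
    have hdvd : ∀ n : ℕ, coeff n g ≠ 0 → p ∣ n := by
      intro n hn
      by_cases h0 : n = 0
      · simp [h0]
      · exact (CharP.cast_eq_zero_iff F p n).1 ((mul_eq_zero.1 (hc n h0)).resolve_left hn)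
    choose r hr using (PerfectRing.bijective_frobenius (R := F) (p := p)).2
    let h : F⟦X⟧ := PowerSeries.mk fun n => r (coeff (p * n) g)
    have hh : h ^ p = g := by
      have := MvPowerSeries.map_frobenius_expand (σ := Unit) p hp0 (f := h)
      refine Eq.trans this.symm ?_
      change PowerSeries.map (frobenius F p) (PowerSeries.expand p hp0 h) = g
      ext n
      rw [PowerSeries.coeff_map, PowerSeries.coeff_expand]
      split_ifs with hpn
      · obtain ⟨q, rfl⟩ := hpn
        rw [Nat.mul_div_cancel_left _ hp.pos, coeff_mk]
        exact hr _
      · rw [map_zero]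
        by_contra hne
        exact hpn (hdvd n (Ne.symm hne))
    obtain ⟨q, rfl⟩ := hdvd k hg
    have hq : q ≠ 0 := by rintro rfl; simp at hk
    obtain ⟨l, h', h1, h2⟩ := ih q (by nlinarith [hp.two_le, Nat.pos_of_ne_zero hq]) hq h (by
      rw [coeff_mk]
      intro h0
      have := hr (coeff (p * q) g)
      simp only [h0] at this
      rw [zero_pow hp0] at this
      exact hg this.symm)
    exact ⟨l + 1, h', by rw [pow_succ, pow_mul, h1, hh], h2⟩
  · exact ⟨0, g, by simp, hd⟩

lemma orderTop_pow' (f : LaurentSeries F) (n : ℕ) : (f ^ n).orderTop = n • f.orderTop := by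
  induction n with
  | zero => simp
  | succ n ih => rw [pow_succ, HahnSeries.orderTop_mul, ih, succ_nsmul]

lemma base1 (p : ℕ) [ExpChar F p] [PerfectRing F p] (g : F⟦X⟧) (hg : ∀ c, g ≠ C c) :
    ∃ (l e : ℕ), (∃ Y : LaurentSeries F, Y ^ (p ^ l) = emb F g) ∧
      ∀ (M : ℕ) (hM : e + 2 ≤ M), ∃ N : ℕ, ∀ y : LaurentSeries F,
        ((N : ℤ) : WithTop ℤ) < (y ^ (p ^ l) - emb F g).orderTop →
        ∃ (z : F⟦X⟧) (τ : LaurentSeries F ≃ₐ[F] LaurentSeries F),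
          (∀ g, τ (emb F g) = emb F (sub M (by omega) z g)) ∧ τ (emb F g) = y ^ (p ^ l) := by
  obtain ⟨k, hk, hgk⟩ : ∃ k, k ≠ 0 ∧ coeff k g ≠ 0 := by
    by_contra! h
    apply hg (constantCoeff g)
    ext n
    by_cases h0 : n = 0
    · simp [h0]
    · rw [h n h0, coeff_C, if_neg h0]
  obtain ⟨l, h, h1, h2⟩ := pth p k hk g hgk
  obtain ⟨e, β, hβ, hd⟩ : ∃ (e : ℕ) (β : F⟦X⟧), IsUnit β ∧ d⁄dX F h = X ^ e * β := by
    have h2' : emb F (d⁄dX F h) ≠ 0 := by rwa [map_ne_zero_iff _ emb_inj]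
    obtain ⟨u, hu, hfu⟩ := exists_unit _ h2'
    have : 0 ≤ (emb F (d⁄dX F h)).order := by
      rw [← HahnSeries.zero_le_orderTop_iff]
      exact (le_emb _ 0).2 (by simp)
    obtain ⟨e, he⟩ := Int.eq_ofNat_of_zero_le this
    refine ⟨e, u, hu, emb_inj ?_⟩
    rw [hfu, he, map_mul, map_pow, zpow_natCast]
  refine ⟨l, e, ⟨emb F h, by rw [← map_pow, h1]⟩, ?_⟩
  intro M hM
  refine ⟨p ^ l * (M + e), ?_⟩
  intro y hy
  have hcast : ExpChar (LaurentSeries F) p := expChar_of_injective_algebraMap (algebraMap F (LaurentSeries F)).injective p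
  have hp : 0 < p ^ l := pow_pos (expChar_pos F p) l
  rw [← h1, map_pow, ← sub_pow_expChar_pow, orderTop_pow'] at hy
  have hy' : (((M + e : ℕ) : ℤ) : WithTop ℤ) ≤ (y - emb F h).orderTop := by
    by_contra! hlt
    have := nsmul_le_nsmul_right hlt.le (p ^ l)
    refine absurd (hy.trans_le this) ?_
    rw [not_lt]
    have e1 : (p ^ l) • (((M + e : ℕ) : ℤ) : WithTop ℤ) = (((p ^ l * (M + e) : ℕ) : ℤ) : WithTop ℤ) := by
      rw [← WithTop.coe_nsmul]
      congr 1
    exact e1.le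
  obtain ⟨w, hw⟩ := exists_emb (y - emb F h) (le_trans (by exact_mod_cast Nat.zero_le _) hy')
  rw [← hw, le_emb] at hy'
  obtain ⟨z, hz⟩ := newton h (h + w) β e M hβ hd hM (by
    rw [sub_add_cancel_left]; exact hy'.neg_right)
  obtain ⟨τ, hτ⟩ := exists_aut M (by omega) z
  refine ⟨z, τ, hτ, ?_⟩
  rw [← h1, map_pow, map_pow, hτ, hz, map_add, hw, add_sub_cancel]

lemma base (p : ℕ) [ExpChar F p] [PerfectRing F p] (a : LaurentSeries F) (ha : Transcendental F a) :
    ∃ (l e : ℕ), (∃ Y : LaurentSeries F, Y ^ (p ^ l) = a) ∧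
      ∀ (M : ℕ) (hM : e + 2 ≤ M), ∃ N : ℕ, ∀ y : LaurentSeries F,
        ((N : ℤ) : WithTop ℤ) < (y ^ (p ^ l) - a).orderTop →
        ∃ (z : F⟦X⟧) (τ : LaurentSeries F ≃ₐ[F] LaurentSeries F),
          (∀ g, τ (emb F g) = emb F (sub M (by omega) z g)) ∧ τ a = y ^ (p ^ l) := by
  have nc : ∀ c : F, emb F (C c) ≠ a := by
    rintro c rfl
    exact ha (isAlgebraic_algebraMap c)
  by_cases h : 0 ≤ a.orderTop
  · obtain ⟨g, rfl⟩ := exists_emb a h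
    exact base1 p g (by rintro c rfl; exact nc c rfl)
  · have ha0 : a ≠ 0 := by rintro rfl; simp at h
    have h' : a.orderTop < 0 := not_le.1 h
    have hord : a.orderTop + a⁻¹.orderTop = 0 := by
      rw [← HahnSeries.orderTop_mul, mul_inv_cancel₀ ha0]; simp
    have hinv : 0 ≤ a⁻¹.orderTop := by
      by_contra! hlt
      have h0 := add_le_add h'.le (le_refl a⁻¹.orderTop)
      rw [hord, zero_add] at h0
      exact absurd hlt (not_lt.2 h0)
    obtain ⟨g, hg⟩ := exists_emb _ hinv
    obtain ⟨l, e, ⟨Y, hY⟩, H⟩ := base1 p g (by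
      rintro c rfl
      apply nc c⁻¹
      rw [emb_C, map_inv₀, ← emb_C, hg, inv_inv])
    refine ⟨l, e, ⟨Y⁻¹, by rw [inv_pow, hY, hg, inv_inv]⟩, ?_⟩
    intro M hM
    obtain ⟨N, hN⟩ := H M hM
    refine ⟨N, ?_⟩
    intro y hy
    set x := y ^ (p ^ l) with hx
    have hxa : x.orderTop = a.orderTop := by
      have : a.orderTop < (x - a).orderTop := h'.trans (lt_of_le_of_lt (by exact_mod_cast Nat.zero_le N) hy)
      have := HahnSeries.orderTop_add_eq_left this
      rwa [add_sub_cancel] at this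
    have hx0 : x ≠ 0 := by
      rintro h0
      rw [h0] at hxa
      rw [← hxa] at h'
      simp at h'
    have e1 : (x⁻¹ - a⁻¹) * (x * a) = - (x - a) := by
      field_simp
      ring
    have e2 : ((N : ℤ) : WithTop ℤ) < (x⁻¹ - emb F g).orderTop := by
      rw [hg]
      by_contra! hlt
      have : (x * a).orderTop ≤ 0 := by
        rw [HahnSeries.orderTop_mul, hxa]
        simpa using add_le_add h'.le h'.le
      have := add_le_add hlt this
      rw [← HahnSeries.orderTop_mul, e1, HahnSeries.orderTop_neg, add_zero] at this
      exact absurd hy (not_lt.2 this)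
    obtain ⟨z, τ, h1, h2⟩ := hN y⁻¹ (by rwa [inv_pow])
    refine ⟨z, τ, h1, ?_⟩
    rw [hg, map_inv₀, inv_pow] at h2
    exact inv_injective h2

open scoped IntermediateField.algebraAdjoinAdjoin Classical in
lemma sep (m : ℕ) (a : Fin (m + 1) → LaurentSeries F) (i : Fin (m+1))
    (hc : i ≠ 0 →  ∃ q : Polynomial (IntermediateField.adjoin F {a 0}),
        q ≠ 0 ∧ q.Separable ∧ Polynomial.aeval (a i) q = 0) :
    ∃ K : ℕ, ∀ x : Fin (m+1) → LaurentSeries F,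
      (∀ q : MvPolynomial (Fin (m + 1)) F,
          MvPolynomial.aeval a q = 0 → MvPolynomial.aeval x q = 0) → x 0 = a 0 →
      ((K : ℤ) : WithTop ℤ) < (x i - a i).orderTop → x i = a i := by
  by_cases hi : i = 0
  · subst hi
    exact ⟨0, fun x _ h _ => h⟩
  obtain ⟨q, hq0, -, hq⟩ := hc hi
  have halg : IsAlgebraic (IntermediateField.adjoin F {a 0}) (a i) := ⟨q, hq0, hq⟩
  have : IsFractionRing (Algebra.adjoin F {a 0}) (IntermediateField.adjoin F {a 0}) := inferInstance
  have halg' : IsAlgebraic (Algebra.adjoin F {a 0}) (a i) :=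
    (IsFractionRing.isAlgebraic_iff (Algebra.adjoin F {a 0}) (IntermediateField.adjoin F {a 0}) (LaurentSeries F)).2 halg
  obtain ⟨Q, hQ0, hQ⟩ := halg'
  have hP : ∀ n, ∃ P : Polynomial F, Polynomial.aeval (a 0) P = (Q.coeff n : LaurentSeries F) := by
    intro n
    have := (Q.coeff n).2
    have h2 := (Algebra.adjoin_singleton_eq_range_aeval F (a 0)).le this
    exact h2
  choose P hP using hP
  let q : MvPolynomial (Fin (m+1)) F :=
    ∑ n ∈ Q.support, Polynomial.aeval (MvPolynomial.X 0) (P n) * MvPolynomial.X i ^ n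
  have hq : ∀ x : Fin (m+1) → LaurentSeries F, x 0 = a 0 →
      MvPolynomial.aeval x q = Polynomial.aeval (x i) Q := by
    intro x hx
    simp only [q, map_sum, map_mul, map_pow, MvPolynomial.aeval_X]
    rw [Polynomial.aeval_eq_sum_range, ← Polynomial.sum_over_range' Q (f := fun n c => c • x i ^ n) (by simp) _ (Nat.lt_succ_self _),
      Polynomial.sum]
    refine Finset.sum_congr rfl fun n _ => ?_
    rw [← Polynomial.aeval_algHom_apply, MvPolynomial.aeval_X, hx, hP]
    rfl
  have hQm : Q.map (algebraMap (Algebra.adjoin F {a 0}) (LaurentSeries F)) ≠ 0 := by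
    rw [Polynomial.map_ne_zero_iff]
    · exact hQ0
    · exact Subtype.val_injective
  set R := (Q.map (algebraMap (Algebra.adjoin F {a 0}) (LaurentSeries F))).roots.toFinset
  refine ⟨∑ r ∈ R, (r - a i).order.natAbs, ?_⟩
  intro x hx hx0 hlt
  by_contra hne
  have hxR : x i ∈ R := by
    rw [Multiset.mem_toFinset, Polynomial.mem_roots hQm, Polynomial.IsRoot, Polynomial.eval_map_algebraMap, ← hq x hx0]
    exact hx q (by rw [hq a rfl, hQ])
  have h1 := Finset.single_le_sum (f := fun r => (r - a i).order.natAbs) (fun _ _ => Nat.zero_le _) hxR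
  rw [← HahnSeries.order_eq_orderTop_of_ne_zero (sub_ne_zero.2 hne)] at hlt
  have h2 : ((∑ r ∈ R, (r - a i).order.natAbs : ℕ) : ℤ) < (x i - a i).order := by exact_mod_cast hlt
  omega

end S15

/-- for a tuple `a = (b, c)` from `F((t))` of transcendence degree `1` over
the perfect field `F` (with `b = a 0` a separating transcendence base and `p` the
characteristic exponent of `F`), there are suitable `l` and `N` such that the orbit of `a`
under `F`-automorphisms equals `locus(a) ∩ U ∩ P_l`, where
`U = ∪_{σ} B(N; σ(a))` and `P_l` is the set of tuples whose first coordinate is a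
`p^l`-th power. -/
theorem statement15 (F : Type*) [Field F] (p : ℕ)
    (hp : (Nat.Prime p ∧ CharP F p) ∨ (p = 1 ∧ CharP F 0)) [PerfectField F]
    (m : ℕ) (a : Fin (m + 1) → LaurentSeries F)
    (hb : Transcendental F (a 0))
    (hc : ∀ i : Fin (m + 1), i ≠ 0 →
      ∃ q : Polynomial (IntermediateField.adjoin F {a 0}),
        q ≠ 0 ∧ q.Separable ∧ Polynomial.aeval (a i) q = 0) :
    ∃ (l : ℕ) (N : Fin (m + 1) → ℕ), ∀ x : Fin (m + 1) → LaurentSeries F,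
      (∃ σ : LaurentSeries F ≃ₐ[F] LaurentSeries F, ∀ i, σ (a i) = x i) ↔
      ((∀ q : MvPolynomial (Fin (m + 1)) F,
          MvPolynomial.aeval a q = 0 → MvPolynomial.aeval x q = 0)
        ∧ (∃ σ : LaurentSeries F ≃ₐ[F] LaurentSeries F,
            ∀ i : Fin (m + 1), ∀ k : ℤ, k ≤ (N i : ℤ) → (x i - σ (a i)).coeff k = 0)
        ∧ (∃ y : LaurentSeries F, y ^ (p ^ l) = x 0)) := by
  have hE : ExpChar F p := by
    rcases hp with ⟨h1, h2⟩ | ⟨rfl, h2⟩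
    · exact ExpChar.prime h1
    · have := CharP.charP_to_charZero F
      exact ExpChar.zero
  have hn : ((p + 1 : ℕ) : F) ≠ 0 := by
    rcases hp with ⟨h1, h2⟩ | ⟨rfl, h2⟩
    · push_cast
      rw [CharP.cast_eq_zero]; simp
    · have := CharP.charP_to_charZero F
      exact Nat.cast_ne_zero.2 (by omega)
  have hn2 : 2 ≤ p + 1 := by have := expChar_pos F p; omega
  have pres := fun σ f => S15.preserve (F := F) (p + 1) hn hn2 σ f
  obtain ⟨l, e, ⟨Y, hY⟩, H⟩ := S15.base p (a 0) hb
  choose K hK using fun i => S15.sep m a i (hc i)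
  choose d hd using fun i => S15.close (p + 1) hn hn2 (a i)
  let M : ℕ := e + 2 + ∑ i, (K i + d i + 1)
  have hM : ∀ i, K i + d i + 1 ≤ M := by
    intro i
    have := Finset.single_le_sum (f := fun i => K i + d i + 1) (fun _ _ => Nat.zero_le _) (Finset.mem_univ i)
    omega
  obtain ⟨N, hN⟩ := H M (by omega)
  refine ⟨l, fun i => N + K i, ?_⟩
  intro x
  have loc : ∀ (τ : LaurentSeries F ≃ₐ[F] LaurentSeries F) (x : Fin (m+1) → LaurentSeries F),
      (∀ q : MvPolynomial (Fin (m + 1)) F,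
          MvPolynomial.aeval a q = 0 → MvPolynomial.aeval x q = 0) →
      (∀ q : MvPolynomial (Fin (m + 1)) F,
          MvPolynomial.aeval a q = 0 → MvPolynomial.aeval (fun i => τ (x i)) q = 0) := by
    intro τ x hx q hq
    have := MvPolynomial.comp_aeval_apply (f := x) (τ : LaurentSeries F →ₐ[F] LaurentSeries F) q
    have h2 : MvPolynomial.aeval (fun i => τ (x i)) q = τ (MvPolynomial.aeval x q) := this.symm
    rw [h2, hx q hq, map_zero]
  constructor
  · rintro ⟨σ, hσ⟩
    obtain rfl : (fun i => σ (a i)) = x := funext hσ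
    refine ⟨loc σ a (fun _ h => h), ⟨σ, fun i k _ => by simp⟩, ⟨σ Y, by rw [← map_pow, hY]⟩⟩
  · rintro ⟨hloc, ⟨σ, hσ⟩, y, hy⟩
    have hσ' : ∀ i, (((N + K i : ℕ) : ℤ) : WithTop ℤ) < (σ.symm (x i) - a i).orderTop := by
      intro i
      rw [← pres σ, map_sub, AlgEquiv.apply_symm_apply]
      refine lt_of_lt_of_le (b := (((N + K i : ℕ) + 1 : ℤ) : WithTop ℤ)) ?_ ?_
      · exact WithTop.coe_lt_coe.2 (Int.lt_succ _)
      · rw [HahnSeries.le_orderTop_iff_forall]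
        intro j hj
        apply hσ
        have : j < ((N + K i : ℕ) : ℤ) + 1 := by exact_mod_cast hj
        exact Int.lt_add_one_iff.1 this
    have hN0 := hσ' 0
    rw [← hy, map_pow] at hN0
    obtain ⟨z, τ, h1, h2⟩ := hN (σ.symm y) (lt_of_le_of_lt (by
      exact_mod_cast (show N ≤ N + K 0 by omega)) hN0)
    rw [← map_pow, hy] at h2
    refine ⟨τ.trans σ, fun i => ?_⟩
    have key := hK i (fun i => τ.symm (σ.symm (x i))) (loc τ.symm _ (loc σ.symm x hloc))
      (by rw [← h2, AlgEquiv.symm_apply_apply]) (by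
        rw [← pres τ, map_sub, AlgEquiv.apply_symm_apply]
        have e1 : σ.symm (x i) - τ (a i) = (σ.symm (x i) - a i) - (τ (a i) - a i) := by ring
        rw [e1]
        refine lt_of_lt_of_le (lt_min ?_ ?_) HahnSeries.min_orderTop_le_orderTop_sub
        · exact lt_of_le_of_lt (by exact_mod_cast (show K i ≤ N + K i by omega)) (hσ' i)
        · have := hd i M (by omega) z τ h1
          by_contra! hlt
          have h3 := this.trans (add_le_add hlt (le_refl _))
          have h4 : (M : ℤ) ≤ K i + d i := by exact_mod_cast h3
          have := hM i
          omega)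
    rw [AlgEquiv.trans_apply, ← key, AlgEquiv.apply_symm_apply, AlgEquiv.apply_symm_apply]
end

section
/- Let F be a perfect field and a a tuple from F((t)) of transcendence degree 1 over F. Then the orbit of a under the group of F-automorphisms of F((t)) coincides with the set of realisations in F((t)) of the complete type of a over F in the language of valued fields with constants for F; that is, two tuples of transcendence degree 1 over F satisfying the same L_vf(F)-formulas are conjugate by an F-automorphism. -/
open FirstOrder Language

/-- A language with a single unary relation symbol `O` (the valuation ring predicate). -/
def valLang : FirstOrder.Language :=
  ⟨fun _ => Empty, fun n => match n with | 1 => PUnit | _ => Empty⟩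

/-- Interpret `O` on `F((t))` as the power series ring `F[[t]]`. -/
instance valLangStructure (F : Type*) [Field F] : valLang.Structure (LaurentSeries F) where
  funMap := fun {_} f _ => f.elim
  RelMap := fun {n} r x =>
    match n, r with
    | 1, _ => ∀ i : ℤ, i < 0 → (x 0).coeff i = 0
    | 0, r => r.elim
    | (_ + 2), r => r.elim

noncomputable instance ringStructure (F : Type*) [Field F] :
    Language.ring.Structure (LaurentSeries F) :=
  (FirstOrder.Ring.compatibleRingOfRing (LaurentSeries F)).toStructure

noncomputable instance constStructure (F : Type*) [Field F] :
    (constantsOn F).Structure (LaurentSeries F) :=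
  constantsOn.structure (algebraMap F (LaurentSeries F))

/-- The language `L_vf(F)` of valued fields with constants for `F`. -/
abbrev Lvf (F : Type*) : FirstOrder.Language := (Language.ring.sum valLang).withConstants F
namespace S16
open PowerSeries

theorem exists_fix {F : Type*} [Field F] (Q : Polynomial (PowerSeries F)) :
    ∃ y : PowerSeries F, y = X * Q.eval y := by
  let G : PowerSeries F → PowerSeries F := fun y => X * Q.eval y
  have hG : ∀ k (a b : PowerSeries F), X ^ k ∣ a - b → X ^ (k+1) ∣ G a - G b := by
    intro k a b h
    have : G a - G b = X * (Q.eval a - Q.eval b) := by simp only [G]; ring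
    rw [this, pow_succ']
    exact mul_dvd_mul_left _ (h.trans (Polynomial.sub_dvd_eval_sub a b Q))
  let s : ℕ → PowerSeries F := fun n => G^[n] 0
  have hs : ∀ n, s (n+1) = G (s n) := fun n => Function.iterate_succ_apply' G n 0
  have h1 : ∀ n, (X : PowerSeries F) ^ n ∣ s n - s (n+1) := by
    intro n
    induction n with
    | zero => simp
    | succ n ih => rw [hs n, hs (n+1)]; exact hG _ _ _ ih
  have h2 : ∀ m k, (X : PowerSeries F) ^ m ∣ s m - s (m + k) := by
    intro m k
    induction k with
    | zero => simp
    | succ k ih =>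
      have := dvd_add ih ((pow_dvd_pow _ (Nat.le_add_right m k)).trans (h1 (m+k)))
      simpa [add_assoc] using this
  have key : ∀ n (a b : PowerSeries F), a ≡ b [SMOD ((Ideal.span {(X : PowerSeries F)}) ^ n • ⊤ :
      Submodule (PowerSeries F) (PowerSeries F))] ↔ X ^ n ∣ a - b := by
    intro n a b
    rw [SModEq.sub_mem, Ideal.span_singleton_pow, smul_eq_mul, Ideal.mul_top,
      Ideal.mem_span_singleton]
  obtain ⟨L, hL⟩ := IsPrecomplete.prec (I := Ideal.span {(X : PowerSeries F)})
    (M := PowerSeries F) inferInstance (f := s) (by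
      intro m n hmn
      obtain ⟨k, rfl⟩ := Nat.exists_eq_add_of_le hmn
      exact (key _ _ _).2 (h2 m k))
  refine ⟨L, ?_⟩
  have h3 : ∀ n, (X : PowerSeries F) ^ n ∣ L - G L := by
    intro n
    have e1 := (key _ _ _).1 (hL n)
    have e2 := hG _ _ _ e1
    have e3 := (pow_dvd_pow (X : PowerSeries F) (Nat.le_succ n)).trans ((key _ _ _).1 (hL (n+1)))
    rw [hs] at e3
    have e4 := (pow_dvd_pow (X : PowerSeries F) (Nat.le_succ n)).trans e2
    have := dvd_sub e4 e3
    simpa using this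
  rw [← sub_eq_zero]
  ext n
  exact (X_pow_dvd_iff.1 (h3 (n+1))) n (Nat.lt_succ_self n)

theorem poly_of_deriv {F : Type*} [Field F] (f : PowerSeries F) (hf : d⁄dX F f ≠ 0) :
    ∃ τ : PowerSeries F, constantCoeff τ = 0 ∧ coeff 1 τ ≠ 0 ∧
      ∃ P : Polynomial F, f = Polynomial.aeval τ P := by
  obtain ⟨r, u, hu, hfu⟩ : ∃ (r : ℕ) (u : PowerSeries F), constantCoeff u ≠ 0 ∧
      d⁄dX F f = X ^ r * u := by
    refine ⟨(d⁄dX F f).order.toNat, divXPowOrder (d⁄dX F f), ?_, ?_⟩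
    · rwa [Ne, constantCoeff_divXPowOrder_eq_zero_iff]
    · rw [X_pow_order_mul_divXPowOrder]
  set N := 2 * r + 2 with hN
  set P := f.trunc N with hP
  set g : PowerSeries F := mk fun i ↦ coeff (i + N) f with hg
  have hfg : f = X ^ N * g + (P : PowerSeries F) := eq_X_pow_mul_shift_add_trunc N f
  obtain ⟨h, hh⟩ : ∃ h, d⁄dX F (X ^ N * g) = X ^ (2 * r + 1) * h := by
    refine ⟨X * d⁄dX F g + (N : PowerSeries F) * g, ?_⟩
    rw [Derivation.leibniz, derivative_pow, derivative_X]
    simp only [smul_eq_mul, hN, show 2 * r + 2 - 1 = 2 * r + 1 by omega]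
    ring
  set u' := u - X ^ (r+1) * h with hu'
  have hu'0 : constantCoeff u' ≠ 0 := by simpa [hu'] using hu
  have hd : ((Polynomial.derivative P : Polynomial F) : PowerSeries F) = X ^ r * u' := by
    rw [← derivative_coe]
    have : d⁄dX F f = X ^ (2 * r + 1) * h + d⁄dX F (P : PowerSeries F) := by
      rw [← hh, ← map_add, ← hfg]
    rw [hfu] at this
    have := eq_sub_of_add_eq' this.symm
    rw [this, hu']; ring
  set d : PowerSeries F := X ^ r * u'
  set PP : Polynomial (PowerSeries F) := P.map (C : F →+* PowerSeries F) with hPP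
  have hev : ∀ p : Polynomial F, (p.map (C : F →+* PowerSeries F)).eval X = (p : PowerSeries F) := by
    intro p
    rw [Polynomial.eval_map]
    exact Polynomial.eval₂_C_X_eq_coe
  set T := Polynomial.taylor (X : PowerSeries F) PP
  set S := T.divX.divX
  have hT : ∀ z, PP.eval (z + X) = (P : PowerSeries F) + d * z + z ^ 2 * S.eval z := by
    intro z
    rw [← Polynomial.taylor_eval]
    change T.eval z = _
    have e0 : T.coeff 0 = P := by rw [Polynomial.taylor_coeff_zero, hPP, hev]
    have e1 : T.divX.coeff 0 = d := by
      rw [Polynomial.coeff_divX, zero_add, Polynomial.taylor_coeff_one, hPP,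
        Polynomial.derivative_map, hev, hd]
    conv_lhs => rw [← Polynomial.divX_mul_X_add T, ← Polynomial.divX_mul_X_add T.divX]
    simp only [Polynomial.eval_add, Polynomial.eval_mul, Polynomial.eval_X, Polynomial.eval_C,
      e0, e1]
    ring
  obtain ⟨y, hy⟩ := exists_fix (Polynomial.C (g * u'⁻¹ ^ 2) -
    Polynomial.X ^ 2 * S.comp (Polynomial.C (X * d) * Polynomial.X))
  simp only [Polynomial.eval_sub, Polynomial.eval_C, Polynomial.eval_mul, Polynomial.eval_pow,
    Polynomial.eval_X, Polynomial.eval_comp] at hy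
  have hy0 : constantCoeff y = 0 := by rw [hy]; simp
  have hinv : u' * u'⁻¹ = 1 := PowerSeries.mul_inv_cancel _ hu'0
  refine ⟨X * d * y + X, by simp, ?_, P, ?_⟩
  · rw [map_add, mul_assoc, ← zero_add 1, coeff_succ_X_mul]
    simp [hy0]
  · rw [Polynomial.aeval_def, ← Polynomial.eval_map]
    change f = PP.eval _
    rw [hT, hfg]
    have : X ^ N * g = X * d ^ 2 * (X * (g * u'⁻¹ ^ 2)) := by
      calc X ^ N * g = X ^ N * g * (u' * u'⁻¹) ^ 2 := by rw [hinv]; ring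
        _ = _ := by simp only [d, hN]; ring
    rw [this]
    linear_combination (- X * d ^ 2) * hy

theorem exists_poly {F : Type*} [Field F] [PerfectField F] :
    ∀ (n : ℕ) (f : PowerSeries F), f ≠ 0 → constantCoeff f = 0 → f.order.toNat = n →
    ∃ τ : PowerSeries F, constantCoeff τ = 0 ∧ coeff 1 τ ≠ 0 ∧
      ∃ P : Polynomial F, f = Polynomial.aeval τ P := by
  intro n
  induction n using Nat.strong_induction_on with
  | _ n ih =>
  intro f hf0 hfc hfn
  by_cases hd : d⁄dX F f = 0
  swap
  · exact poly_of_deriv f hd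
  have hcoef : ∀ k : ℕ, coeff k f = 0 ∨ (k : F) = 0 := by
    intro k
    cases k with
    | zero => left; simpa using hfc
    | succ k =>
      have := congrArg (coeff k) hd
      rw [coeff_derivative] at this
      simpa using this
  obtain ⟨p, hpE⟩ := ExpChar.exists F
  obtain ⟨hp', hpC⟩ : p.Prime ∧ CharP F p := by
    cases hpE with
    | zero =>
      exfalso; apply hf0; ext k
      rcases hcoef k with h | h
      · simpa using h
      · have : k = 0 := by simpa using h
        subst this; simpa using hfc
    | prime h => exact ⟨h, inferInstance⟩
  have : Fact p.Prime := ⟨hp'⟩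
  have : PerfectRing F p := inferInstance
  let e : PowerSeries F := mk fun k => (frobeniusEquiv F p).symm (coeff (p * k) f)
  have he : e ^ p = f := by
    have h0 := MvPowerSeries.map_frobenius_expand (R := F) p hp'.ne_zero (f := e)
    change PowerSeries.map (frobenius F p) (PowerSeries.expand p hp'.ne_zero e) = _ at h0
    rw [← h0]
    ext k
    rw [coeff_map, coeff_expand]
    by_cases hk : p ∣ k
    · obtain ⟨l, rfl⟩ := hk
      simp [e, Nat.mul_div_cancel_left _ hp'.pos]
      try exact frobenius_apply_frobeniusEquiv_symm ..
    · rw [if_neg hk, map_zero]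
      rcases hcoef k with h | h
      · exact h.symm
      · exact absurd ((CharP.cast_eq_zero_iff F p k).1 h) hk
  have he0 : e ≠ 0 := by
    rintro h; rw [h, zero_pow hp'.ne_zero] at he; exact hf0 he.symm
  have hec : constantCoeff e = 0 := by
    have := congrArg constantCoeff he
    rw [map_pow, hfc] at this
    exact pow_eq_zero_iff hp'.ne_zero |>.1 this
  have hord : f.order = p * e.order := by
    rw [← he, order_pow]; simp
  have hlt : e.order.toNat < n := by
    have h1 : e.order.toNat ≠ 0 := by
      intro h
      have := constantCoeff_divXPowOrder_eq_zero_iff.not.2 he0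
      have h2 := X_pow_order_mul_divXPowOrder (f := e)
      rw [h, pow_zero, one_mul] at h2
      rw [h2] at this
      exact this hec
    rw [← hfn, hord, ENat.toNat_mul, ENat.toNat_natCast]
    have := hp'.two_le
    nlinarith [Nat.pos_of_ne_zero h1]
  obtain ⟨τ, h1, h2, P, hP⟩ := ih _ hlt e he0 hec rfl
  exact ⟨τ, h1, h2, P ^ p, by rw [map_pow, ← hP, he]⟩
end S16
namespace S16
open PowerSeries

def isO {F : Type*} [Field F] (z : LaurentSeries F) : Prop := ∀ i : ℤ, i < 0 → z.coeff i = 0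

theorem isO_coe {F : Type*} [Field F] (f : PowerSeries F) :
    isO (HahnSeries.ofPowerSeries ℤ F f) := by
  intro i hi
  rw [PowerSeries.coeff_coe, if_pos hi]

theorem isO_iff {F : Type*} [Field F] (z : LaurentSeries F) :
    isO z ↔ ∃ f : PowerSeries F, HahnSeries.ofPowerSeries ℤ F f = z := by
  constructor
  · intro h
    refine ⟨PowerSeries.mk fun n => z.coeff n, ?_⟩
    ext i
    rw [PowerSeries.coeff_coe]
    split_ifs with hi
    · exact (h i hi).symm
    · rw [coeff_mk]
      congr 1
      omega
  · rintro ⟨f, rfl⟩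
    exact isO_coe f

theorem isO_order {F : Type*} [Field F] {z : LaurentSeries F} (hz : z ≠ 0) :
    isO z ↔ 0 ≤ z.order := by
  constructor
  · intro h
    by_contra hn
    exact hz (HahnSeries.coeff_order_eq_zero.1 (h _ (not_le.1 hn)))
  · intro h i hi
    exact HahnSeries.coeff_eq_zero_of_lt_order (lt_of_lt_of_le hi h)

theorem isO_add {F : Type*} [Field F] {z w : LaurentSeries F} (hz : isO z) (hw : isO w) :
    isO (z + w) := by
  intro i hi
  rw [HahnSeries.coeff_add, hz i hi, hw i hi, add_zero]

theorem isO_C {F : Type*} [Field F] (c : F) : isO (algebraMap F (LaurentSeries F) c) := by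
  rw [LaurentSeries.algebraMap_apply, ← PowerSeries.coe_C]
  exact isO_coe _

theorem exists_root {F : Type*} [Field F] (f : PowerSeries F) (hf : constantCoeff f = 1)
    (n : ℕ) (hn : (n : F) ≠ 0) : ∃ g : PowerSeries F, g ^ n = f := by
  have hn0 : n ≠ 0 := by rintro rfl; simp at hn
  let I := Ideal.span {(X : PowerSeries F)}
  have hmem : ∀ g : PowerSeries F, g ∈ I ↔ constantCoeff g = 0 := by
    intro g; rw [Ideal.mem_span_singleton, X_dvd_iff]
  obtain ⟨g, hg, -⟩ := HenselianRing.is_henselian (I := I) (Polynomial.X ^ n - Polynomial.C f)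
    (Polynomial.monic_X_pow_sub_C f hn0) 1 (by rw [hmem]; simp [hf]) (by
      apply IsUnit.map
      rw [PowerSeries.isUnit_iff_constantCoeff]
      rw [Polynomial.derivative_sub, Polynomial.derivative_X_pow, Polynomial.derivative_C]
      simp [hn])
  refine ⟨g, ?_⟩
  have : g ^ n - f = 0 := by simpa [Polynomial.IsRoot] using hg
  exact sub_eq_zero.1 this

theorem aut_isO {F : Type*} [Field F] (σ : LaurentSeries F ≃ₐ[F] LaurentSeries F)
    {z : LaurentSeries F} (hz : isO z) : isO (σ z) := by
  obtain ⟨f, rfl⟩ := (isO_iff z).1 hz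
  set c := constantCoeff f
  set g := f - C c with hg
  have hg0 : constantCoeff g = 0 := by simp [g, c]
  have hfg : HahnSeries.ofPowerSeries ℤ F f = algebraMap F (LaurentSeries F) (c - 1) +
      HahnSeries.ofPowerSeries ℤ F (1 + g) := by
    rw [LaurentSeries.algebraMap_apply, ← PowerSeries.coe_C, ← map_add]
    congr 1
    rw [hg, map_sub, map_one]; ring
  rw [hfg, map_add, AlgEquiv.commutes]
  refine isO_add (isO_C _) ?_
  set w := σ (HahnSeries.ofPowerSeries ℤ F (1 + g)) with hw
  have hw0 : w ≠ 0 := by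
    rw [hw, Ne, EmbeddingLike.map_eq_zero_iff]
    intro h
    have h2 : (1 + g) = 0 := HahnSeries.ofPowerSeries_injective (by rw [h, map_zero])
    have := congrArg constantCoeff h2
    simp [hg0] at this
  rw [isO_order hw0]
  have key : ∀ n : ℕ, (n : F) ≠ 0 → (n : ℤ) ∣ w.order := by
    intro n hn
    obtain ⟨r, hr⟩ := exists_root (1 + g) (by simp [hg0]) n hn
    refine ⟨(σ (HahnSeries.ofPowerSeries ℤ F r)).order, ?_⟩
    rw [hw, ← hr, map_pow, map_pow, HahnSeries.order_pow]
    simp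
  by_contra hneg
  obtain ⟨n, hn, hn'⟩ : ∃ n : ℕ, (n : F) ≠ 0 ∧ w.order.natAbs < n := by
    by_cases h : ((w.order.natAbs + 1 : ℕ) : F) = 0
    · refine ⟨w.order.natAbs + 2, ?_, by omega⟩
      intro h2
      push_cast at h h2
      have : (1 : F) = 0 := by linear_combination h2 - h
      exact one_ne_zero this
    · exact ⟨_, h, by omega⟩
  have := Int.natAbs_dvd_natAbs.2 (key n hn)
  have := Nat.le_of_dvd (by omega) this
  simp at this
  omega

theorem aut_isO_iff {F : Type*} [Field F] (σ : LaurentSeries F ≃ₐ[F] LaurentSeries F)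
    {z : LaurentSeries F} : isO (σ z) ↔ isO z := by
  refine ⟨fun h => ?_, aut_isO σ⟩
  simpa using aut_isO σ.symm h

theorem exists_aut {F : Type*} [Field F] (τ : PowerSeries F) (h0 : constantCoeff τ = 0)
    (h1 : coeff 1 τ ≠ 0) : ∃ σ : LaurentSeries F ≃ₐ[F] LaurentSeries F,
      σ (HahnSeries.ofPowerSeries ℤ F X) = HahnSeries.ofPowerSeries ℤ F τ := by
  have hu : IsUnit (coeff 1 τ) := isUnit_iff_ne_zero.2 h1
  have hτ : HasSubst τ := HasSubst.of_constantCoeff_zero' h0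
  have hρ : HasSubst (substInvOfIsUnit τ hu) := HasSubst.substInvOfIsUnit τ hu
  let e : PowerSeries F ≃ₐ[F] PowerSeries F := AlgEquiv.ofAlgHom
    (substAlgHom (R := F) hτ) (substAlgHom (R := F) hρ)
    (by
      ext1 f
      simp only [AlgHom.comp_apply, coe_substAlgHom, AlgHom.id_apply]
      rw [subst_comp_subst_apply hρ hτ, subst_substInvOfIsUnit_left τ h0 hu, X_subst])
    (by
      ext1 f
      simp only [AlgHom.comp_apply, coe_substAlgHom, AlgHom.id_apply]
      rw [subst_comp_subst_apply hτ hρ, subst_substInvOfIsUnit_right τ h0 hu, X_subst])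
  have hC : ∀ c : F, algebraMap F (LaurentSeries F) c =
      algebraMap (PowerSeries F) (LaurentSeries F) (algebraMap F (PowerSeries F) c) := by
    intro c
    rw [LaurentSeries.algebraMap_apply, ← PowerSeries.coe_C]
    rfl
  have he := IsFractionRing.ringEquivOfRingEquiv_algebraMap (K := LaurentSeries F)
    (L := LaurentSeries F) e.toRingEquiv
  refine ⟨AlgEquiv.ofRingEquiv
    (f := IsFractionRing.ringEquivOfRingEquiv (K := LaurentSeries F) (L := LaurentSeries F)
      e.toRingEquiv) ?_, ?_⟩
  · intro c
    rw [hC, he]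
    congr 1
    exact e.commutes c
  · refine (he X).trans ?_
    rw [LaurentSeries.coe_algebraMap]
    congr 1
    exact substAlgHom_X hτ

end S16

namespace S16
section logic
open FirstOrder

theorem relMap_iff {F : Type*} [Field F] (x : Fin 1 → LaurentSeries F) :
    Language.Structure.RelMap (L := valLang) (M := LaurentSeries F) (n := 1) PUnit.unit x ↔
      isO (x 0) := Iff.rfl

theorem realize_aut {F : Type*} [Field F] {α : Type*}
    (σ : LaurentSeries F ≃ₐ[F] LaurentSeries F)
    (φ : (Lvf F).Formula α) (v : α → LaurentSeries F) :
    φ.Realize (fun i => σ (v i)) ↔ φ.Realize v := by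
  let e : LaurentSeries F ≃[Lvf F] LaurentSeries F :=
    { σ.toEquiv with
      map_fun' := by
        intro n f x
        rcases f with (f | f) | f
        · cases f with
          | add => exact map_add σ _ _
          | mul => exact map_mul σ _ _
          | neg => exact map_neg σ _
          | zero => exact map_zero σ
          | one => exact map_one σ
        · exact f.elim
        · cases n with
          | zero => exact σ.commutes f
          | succ n => exact isEmptyElim f
      map_rel' := by
        intro n r x
        rcases r with (r | r) | r
        · exact isEmptyElim r
        · match n, r with
          | 0, r => exact r.elim
          | 1, r => exact aut_isO_iff σ (z := x 0)
          | (_ + 2), r => exact r.elim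
        · exact r.elim }
  exact Language.StrongHomClass.realize_formula e φ

/-- A function given by a term. -/
def Rep (F : Type*) [Field F] {α : Type*} (f : (α → LaurentSeries F) → LaurentSeries F) : Prop :=
  ∃ t : (Lvf F).Term α, ∀ v, t.realize v = f v

variable {F : Type*} [Field F] {α : Type*} {f g : (α → LaurentSeries F) → LaurentSeries F}

theorem Rep.var (i : α) : Rep F (fun v : α → LaurentSeries F => v i) :=
  ⟨.var i, fun _ => rfl⟩

theorem Rep.const (c : F) :
    Rep F (fun _ : α → LaurentSeries F => algebraMap F (LaurentSeries F) c) :=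
  ⟨.func (l := 0) (Sum.inr c) Fin.elim0, fun _ => rfl⟩

theorem Rep.add (hf : Rep F f) (hg : Rep F g) : Rep F (fun v => f v + g v) := by
  obtain ⟨s, hs⟩ := hf
  obtain ⟨t, ht⟩ := hg
  refine ⟨.func (l := 2) (Sum.inl (Sum.inl FirstOrder.ringFunc.add)) ![s, t], fun v => ?_⟩
  obtain rfl : f = fun v => s.realize v := funext fun v => (hs v).symm
  obtain rfl : g = fun v => t.realize v := funext fun v => (ht v).symm
  rfl

theorem Rep.mul (hf : Rep F f) (hg : Rep F g) : Rep F (fun v => f v * g v) := by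
  obtain ⟨s, hs⟩ := hf
  obtain ⟨t, ht⟩ := hg
  refine ⟨.func (l := 2) (Sum.inl (Sum.inl FirstOrder.ringFunc.mul)) ![s, t], fun v => ?_⟩
  obtain rfl : f = fun v => s.realize v := funext fun v => (hs v).symm
  obtain rfl : g = fun v => t.realize v := funext fun v => (ht v).symm
  rfl

theorem Rep.zero : Rep F (fun _ : α → LaurentSeries F => 0) := by
  simpa using Rep.const (F := F) (α := α) 0

theorem Rep.one : Rep F (fun _ : α → LaurentSeries F => 1) := by
  simpa using Rep.const (F := F) (α := α) 1

theorem Rep.pow (hf : Rep F f) (n : ℕ) : Rep F (fun v => f v ^ n) := by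
  induction n with
  | zero => simpa using Rep.one
  | succ n ih => simpa [pow_succ] using ih.mul hf

theorem Rep.poly (hf : Rep F f) (p : Polynomial F) :
    Rep F (fun v => Polynomial.aeval (f v) p) := by
  induction p using Polynomial.induction_on' with
  | add p q hp hq => simpa using hp.add hq
  | monomial n c => simpa [Polynomial.aeval_monomial] using (Rep.const c).mul (hf.pow n)

/-- Evaluation of a bivariate polynomial. -/
noncomputable def bi (Q : Polynomial (Polynomial F)) (s y : LaurentSeries F) : LaurentSeries F :=
  Polynomial.eval₂ (Polynomial.aeval (R := F) s).toRingHom y Q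

theorem Rep.bi (hf : Rep F f) (hg : Rep F g) (Q : Polynomial (Polynomial F)) :
    Rep F (fun v => S16.bi Q (f v) (g v)) := by
  unfold S16.bi
  induction Q using Polynomial.induction_on' with
  | add p q hp hq => simpa [Polynomial.eval₂_add] using hp.add hq
  | monomial n c => simpa [Polynomial.eval₂_monomial] using (hf.poly c).mul (hg.pow n)

/-- A definable predicate. -/
def Dfn (F : Type*) [Field F] {α : Type*} (S : (α → LaurentSeries F) → Prop) : Prop :=
  ∃ φ : (Lvf F).Formula α, ∀ v, φ.Realize v ↔ S v

variable {S T : (α → LaurentSeries F) → Prop}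

theorem Dfn.eq (hf : Rep F f) (hg : Rep F g) : Dfn F (fun v => f v = g v) := by
  obtain ⟨s, hs⟩ := hf
  obtain ⟨t, ht⟩ := hg
  exact ⟨s.equal t, fun v => by rw [Language.Formula.realize_equal, hs, ht]⟩

theorem Dfn.isO (hf : Rep F f) : Dfn F (fun v => isO (f v)) := by
  obtain ⟨s, hs⟩ := hf
  refine ⟨Language.Relations.formula (n := 1) (L := Lvf F) (Sum.inl (Sum.inr PUnit.unit)) ![s],
    fun v => ?_⟩
  obtain rfl : f = fun v => s.realize v := funext fun v => (hs v).symm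
  refine Language.Formula.realize_rel.trans ?_
  exact relMap_iff (F := F) (fun i => Language.Term.realize v (![s] i))

theorem Dfn.and (hS : Dfn F S) (hT : Dfn F T) : Dfn F (fun v => S v ∧ T v) := by
  obtain ⟨s, hs⟩ := hS
  obtain ⟨t, ht⟩ := hT
  exact ⟨s ⊓ t, fun v => by rw [Language.Formula.realize_inf, hs, ht]⟩

theorem Dfn.not (hS : Dfn F S) : Dfn F (fun v => ¬ S v) := by
  obtain ⟨s, hs⟩ := hS
  exact ⟨s.not, fun v => by rw [Language.Formula.realize_not, hs]⟩

theorem Dfn.imp (hS : Dfn F S) (hT : Dfn F T) : Dfn F (fun v => S v → T v) := by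
  obtain ⟨s, hs⟩ := hS
  obtain ⟨t, ht⟩ := hT
  exact ⟨s.imp t, fun v => by rw [Language.Formula.realize_imp, hs, ht]⟩

theorem Dfn.forallFin {ι : Type*} [Finite ι] {S : ι → (α → LaurentSeries F) → Prop}
    (hS : ∀ i, Dfn F (S i)) : Dfn F (fun v => ∀ i, S i v) := by
  choose s hs using hS
  exact ⟨Language.Formula.iInf s, fun v => by rw [Language.Formula.realize_iInf]; simp only [hs]⟩

theorem Dfn.ex {β : Type*} [Finite β] {S : (α ⊕ β → LaurentSeries F) → Prop}
    (hS : Dfn F S) : Dfn F (fun v => ∃ w : β → LaurentSeries F, S (Sum.elim v w)) := by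
  obtain ⟨s, hs⟩ := hS
  exact ⟨s.iExs β, fun v => by rw [Language.Formula.realize_iExs]; simp only [hs]⟩

theorem Dfn.all {β : Type*} [Finite β] {S : (α ⊕ β → LaurentSeries F) → Prop}
    (hS : Dfn F S) : Dfn F (fun v => ∀ w : β → LaurentSeries F, S (Sum.elim v w)) := by
  obtain ⟨s, hs⟩ := hS
  exact ⟨s.iAlls β, fun v => by rw [Language.Formula.realize_iAlls]; simp only [hs]⟩

/-- Uniformizers. -/
def Unif (s : LaurentSeries F) : Prop :=
  s ≠ 0 ∧ isO s ∧ ∀ u : Fin 2 → LaurentSeries F,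
    (s * u 0 = 1 → ¬ isO (u 0)) ∧ (u 0 * s * u 1 = 1 → ¬ isO (u 0) → isO (u 1))

theorem Dfn.unif (i : α) : Dfn F (fun v : α → LaurentSeries F => Unif (v i)) := by
  refine (Dfn.eq (.var i) .zero).not.and ((Dfn.isO (.var i)).and ?_)
  have h0 : Rep F (fun v : (α ⊕ Fin 2) → LaurentSeries F => v (Sum.inr 0)) := .var _
  have h1 : Rep F (fun v : (α ⊕ Fin 2) → LaurentSeries F => v (Sum.inr 1)) := .var _
  have hs : Rep F (fun v : (α ⊕ Fin 2) → LaurentSeries F => v (Sum.inl i)) := .var _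
  exact (((Dfn.eq (hs.mul h0) .one).imp (Dfn.isO h0).not).and
    ((Dfn.eq ((h0.mul hs).mul h1) .one).imp ((Dfn.isO h0).not.imp (Dfn.isO h1)))).all

theorem unif_iff (s : LaurentSeries F) : Unif s ↔ s ≠ 0 ∧ s.order = 1 := by
  have hmul : ∀ {x y : LaurentSeries F}, x * y = 1 → x ≠ 0 ∧ y ≠ 0 ∧ x.order + y.order = 0 := by
    intro x y h
    have hx : x ≠ 0 := by rintro rfl; simp at h
    have hy : y ≠ 0 := by rintro rfl; simp at h
    refine ⟨hx, hy, ?_⟩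
    rw [← HahnSeries.order_mul hx hy, h, HahnSeries.order_one]
  constructor
  · rintro ⟨h0, hO, h⟩
    refine ⟨h0, ?_⟩
    rw [isO_order h0] at hO
    have h1 : s.order ≠ 0 := by
      intro h1
      have e : s * s⁻¹ = 1 := mul_inv_cancel₀ h0
      obtain ⟨-, hi, ho⟩ := hmul e
      refine (h (fun _ => s⁻¹)).1 e ?_
      rw [isO_order hi]; omega
    by_contra h2
    have hx0 : (HahnSeries.single (-1 : ℤ) (1 : F) : LaurentSeries F) ≠ 0 := by simp
    have hxo : (HahnSeries.single (-1 : ℤ) (1 : F) : LaurentSeries F).order = -1 :=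
      HahnSeries.order_single one_ne_zero
    set x : LaurentSeries F := HahnSeries.single (-1 : ℤ) (1 : F)
    have e : x * s * (x * s)⁻¹ = 1 := mul_inv_cancel₀ (mul_ne_zero hx0 h0)
    obtain ⟨-, hi, ho⟩ := hmul e
    rw [HahnSeries.order_mul hx0 h0] at ho
    have := (h ![x, (x * s)⁻¹]).2 e (by
      change ¬ S16.isO x
      rw [isO_order hx0]; omega)
    change S16.isO (x * s)⁻¹ at this
    rw [isO_order hi] at this
    omega
  · rintro ⟨h0, h1⟩
    refine ⟨h0, (isO_order h0).2 (by omega), fun u => ⟨fun e => ?_, fun e => ?_⟩⟩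
    · obtain ⟨-, hi, ho⟩ := hmul e
      rw [isO_order hi]; omega
    · obtain ⟨hu, hi, ho⟩ := hmul e
      have hu0 : u 0 ≠ 0 := left_ne_zero_of_mul hu
      rw [HahnSeries.order_mul hu0 h0] at ho
      rw [isO_order hi, isO_order hu0]; omega

theorem unif_aut {s : LaurentSeries F} (hs : Unif s) :
    ∃ σ : LaurentSeries F ≃ₐ[F] LaurentSeries F,
      σ (HahnSeries.ofPowerSeries ℤ F PowerSeries.X) = s := by
  obtain ⟨f, rfl⟩ := (isO_iff s).1 hs.2.1
  obtain ⟨h0, h1⟩ := (unif_iff _).1 hs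
  have hc : ∀ n : ℕ, PowerSeries.coeff n f = (HahnSeries.ofPowerSeries ℤ F f).coeff n := by
    intro n; simp
  apply exists_aut
  · rw [← PowerSeries.coeff_zero_eq_constantCoeff_apply, hc]
    exact HahnSeries.coeff_eq_zero_of_lt_order (by rw [h1]; simp)
  · rw [hc, Nat.cast_one, ← h1]
    exact HahnSeries.coeff_order_eq_zero.not.2 h0

theorem unif_coe {τ : PowerSeries F} (h0 : PowerSeries.constantCoeff τ = 0)
    (h1 : PowerSeries.coeff 1 τ ≠ 0) : Unif (HahnSeries.ofPowerSeries ℤ F τ) := by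
  rw [unif_iff]
  have hc : ∀ n : ℕ, PowerSeries.coeff n τ = (HahnSeries.ofPowerSeries ℤ F τ).coeff n := by
    intro n; simp
  have hne : HahnSeries.ofPowerSeries ℤ F τ ≠ 0 := by
    intro h
    apply h1
    rw [hc, h]; simp
  refine ⟨hne, le_antisymm ?_ ?_⟩
  · apply HahnSeries.order_le_of_coeff_ne_zero
    have := hc 1
    rw [Nat.cast_one] at this
    rwa [← this]
  · have := (isO_order hne).1 (isO_coe τ)
    rcases this.lt_or_eq with h | h
    · omega
    · exfalso
      refine hne (HahnSeries.coeff_order_eq_zero.1 ?_)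
      rw [← h]
      have := hc 0
      rw [Nat.cast_zero] at this
      rw [← this, PowerSeries.coeff_zero_eq_constantCoeff_apply, h0]

end logic
end S16

namespace S16
section final

variable {F : Type*} [Field F]

theorem coe_C' (c : F) : HahnSeries.ofPowerSeries ℤ F (PowerSeries.C c) =
    algebraMap F (LaurentSeries F) c := by
  rw [LaurentSeries.algebraMap_apply, HahnSeries.ofPowerSeries_C]

theorem coe_aeval (τ : PowerSeries F) (P : Polynomial F) :
    HahnSeries.ofPowerSeries ℤ F (Polynomial.aeval τ P) =
      Polynomial.aeval (HahnSeries.ofPowerSeries ℤ F τ) P := by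
  rw [Polynomial.aeval_def, Polynomial.hom_eval₂, Polynomial.aeval_def]
  congr 1

/-- A transcendental element lies in `F(s)` for a uniformizer `s`. -/
theorem exists_unif [PerfectField F] {y : LaurentSeries F} (hy : Transcendental F y) :
    ∃ s : LaurentSeries F, Unif s ∧ y ∈ IntermediateField.adjoin F {s} := by
  have key : ∀ f : PowerSeries F, f ≠ 0 → PowerSeries.constantCoeff f = 0 →
      ∃ s : LaurentSeries F, Unif s ∧
        HahnSeries.ofPowerSeries ℤ F f ∈ IntermediateField.adjoin F {s} := by
    intro f hf h0
    obtain ⟨τ, h0', h1, P, rfl⟩ := exists_poly _ f hf h0 rfl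
    refine ⟨_, unif_coe h0' h1, ?_⟩
    rw [coe_aeval]
    have h := IntermediateField.mem_adjoin_simple_self F (HahnSeries.ofPowerSeries ℤ F τ)
    exact (IntermediateField.algebra_adjoin_le_adjoin F {HahnSeries.ofPowerSeries ℤ F τ})
      (Polynomial.aeval_mem_adjoin_singleton F _)
  by_cases hO : isO y
  · obtain ⟨f, rfl⟩ := (isO_iff y).1 hO
    obtain ⟨s, hs, hm⟩ := key (f - PowerSeries.C (PowerSeries.constantCoeff f)) (by
      intro h
      rw [sub_eq_zero] at h
      rw [h, coe_C'] at hy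
      exact hy (isAlgebraic_algebraMap _)) (by simp)
    refine ⟨s, hs, ?_⟩
    rw [map_sub, coe_C'] at hm
    simpa using add_mem hm
      (IntermediateField.algebraMap_mem _ (PowerSeries.constantCoeff f))
  · have hy0 : y ≠ 0 := by
      rintro rfl
      exact hy isAlgebraic_zero
    have hi0 : y⁻¹ ≠ 0 := inv_ne_zero hy0
    rw [isO_order hy0] at hO
    have ho : y.order + (y⁻¹).order = 0 := by
      rw [← HahnSeries.order_mul hy0 hi0, mul_inv_cancel₀ hy0, HahnSeries.order_one]
    obtain ⟨f, hf⟩ := (isO_iff y⁻¹).1 ((isO_order hi0).2 (by omega))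
    have hf0 : f ≠ 0 := by
      rintro rfl
      rw [map_zero] at hf
      exact hi0 hf.symm
    have hc : PowerSeries.constantCoeff f = 0 := by
      have : PowerSeries.coeff 0 f = (HahnSeries.ofPowerSeries ℤ F f).coeff (0 : ℕ) :=
        (HahnSeries.ofPowerSeries_apply_coeff f 0).symm
      rw [← PowerSeries.coeff_zero_eq_constantCoeff_apply, this, hf]
      exact HahnSeries.coeff_eq_zero_of_lt_order (by simp; omega)
    obtain ⟨s, hs, hm⟩ := key f hf0 hc
    refine ⟨s, hs, ?_⟩
    rw [hf] at hm
    simpa using inv_mem hm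

open scoped IntermediateField.algebraAdjoinAdjoin in
theorem exists_bi {s y : LaurentSeries F} (h : IsAlgebraic (IntermediateField.adjoin F {s}) y) :
    ∃ Q : Polynomial (Polynomial F),
      Q.map (Polynomial.aeval (R := F) s).toRingHom ≠ 0 ∧ bi Q s y = 0 := by
  have h' : IsAlgebraic (Algebra.adjoin F {s}) y :=
    (IsFractionRing.isAlgebraic_iff (Algebra.adjoin F {s}) (IntermediateField.adjoin F {s})
      (LaurentSeries F)).2 h
  obtain ⟨p, hp, hpy⟩ := h'
  have hsurj : ∀ z : Algebra.adjoin F {s}, ∃ c : Polynomial F, Polynomial.aeval s c = z := by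
    intro z
    have h2 : (z : LaurentSeries F) ∈ (Polynomial.aeval (R := F) s).range :=
      (Algebra.adjoin_singleton_eq_range_aeval F s).le z.2
    exact h2
  let r : Polynomial F →+* Algebra.adjoin F {s} :=
    ((Polynomial.aeval (R := F) s).codRestrict (Algebra.adjoin F {s})
      (fun c => Polynomial.aeval_mem_adjoin_singleton F s)).toRingHom
  have hr : Function.Surjective r := by
    intro z
    obtain ⟨c, hc⟩ := hsurj z
    exact ⟨c, Subtype.ext hc⟩
  obtain ⟨Q, rfl⟩ := Polynomial.map_surjective r hr p
  have hcomp : (algebraMap (Algebra.adjoin F {s}) (LaurentSeries F)).comp r =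
      (Polynomial.aeval (R := F) s).toRingHom := rfl
  refine ⟨Q, ?_, ?_⟩
  · rw [← hcomp, ← Polynomial.map_map]
    exact (Polynomial.map_ne_zero_iff Subtype.val_injective).2 hp
  · unfold bi
    rw [← hcomp, ← Polynomial.eval₂_map]
    exact hpy

theorem isO_mul {z w : LaurentSeries F} (hz : isO z) (hw : isO w) : isO (z * w) := by
  obtain ⟨f, rfl⟩ := (isO_iff z).1 hz
  obtain ⟨g, rfl⟩ := (isO_iff w).1 hw
  rw [← map_mul]
  exact isO_coe _

/-- Approximation of elements by polynomials in a uniformizer. -/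
theorem approx {s : LaurentSeries F} (hs : Unif s) (z : LaurentSeries F) (N : ℕ) :
    ∃ (k : ℕ) (c : Polynomial F) (w : LaurentSeries F), isO w ∧
      s ^ k * z = Polynomial.aeval s c + s ^ (N + k) * w := by
  obtain ⟨σ, hσ⟩ := unif_aut hs
  have hX : Unif (HahnSeries.ofPowerSeries ℤ F PowerSeries.X) :=
    unif_coe (by simp) (by simp)
  obtain ⟨hX0, hX1⟩ := (unif_iff _).1 hX
  set T : LaurentSeries F := HahnSeries.ofPowerSeries ℤ F PowerSeries.X with hT
  have hO : isO (T ^ (σ.symm z).order.natAbs * σ.symm z) := by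
    by_cases h0 : σ.symm z = 0
    · rw [h0, mul_zero]
      intro i _
      simp
    · rw [isO_order (mul_ne_zero (pow_ne_zero _ hX0) h0),
        HahnSeries.order_mul (pow_ne_zero _ hX0) h0, HahnSeries.order_pow, hX1]
      simp only [nsmul_eq_mul, mul_one]
      omega
  obtain ⟨f, hf⟩ := (isO_iff _).1 hO
  set k := (σ.symm z).order.natAbs
  have hd := PowerSeries.eq_X_pow_mul_shift_add_trunc (N + k) f
  refine ⟨k, PowerSeries.trunc (N + k) f,
    σ (HahnSeries.ofPowerSeries ℤ F (PowerSeries.mk fun i => PowerSeries.coeff (i + (N + k)) f)),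
    aut_isO σ (isO_coe _), ?_⟩
  have hcoe : HahnSeries.ofPowerSeries ℤ F (PowerSeries.trunc (N + k) f : PowerSeries F) =
      Polynomial.aeval T (PowerSeries.trunc (N + k) f) := by
    rw [hT, ← coe_aeval]
    congr 1
    induction (PowerSeries.trunc (N + k) f) using Polynomial.induction_on' with
    | add p q hp hq => rw [Polynomial.coe_add, hp, hq, map_add]
    | monomial n c =>
      rw [Polynomial.aeval_monomial, ← Polynomial.C_mul_X_pow_eq_monomial, Polynomial.coe_mul,
        Polynomial.coe_pow, Polynomial.coe_C, Polynomial.coe_X]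
      rfl
  have h2 : σ (HahnSeries.ofPowerSeries ℤ F f) = s ^ k * z := by
    rw [hf, map_mul, map_pow, hσ, AlgEquiv.apply_symm_apply]
  rw [← h2]
  nth_rewrite 1 [hd]
  rw [map_add, map_add, hcoe, map_mul, map_mul, map_pow, map_pow, ← hT, hσ, add_comm]
  congr 1
  rw [← hσ]
  exact (Polynomial.aeval_algHom_apply σ.toAlgHom T _).symm

theorem unique {s y : LaurentSeries F} (hs : Unif s) {Q : Polynomial (Polynomial F)}
    (hQ : Q.map (Polynomial.aeval (R := F) s).toRingHom ≠ 0) :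
    ∃ N : ℕ, ∀ (z w : LaurentSeries F) (k : ℕ), bi Q s z = 0 → isO w →
      s ^ k * (z - y) = s ^ (N + k) * w → z = y := by
  obtain ⟨h0, h1⟩ := (unif_iff _).1 hs
  set q := Q.map (Polynomial.aeval (R := F) s).toRingHom
  classical
  refine ⟨(q.roots.toFinset.sup fun r => (r - y).order.natAbs) + 1, fun z w k hz hw h => ?_⟩
  by_contra hne
  have hmem : z ∈ q.roots.toFinset := by
    rw [Multiset.mem_toFinset, Polynomial.mem_roots hQ, Polynomial.IsRoot.def,
      Polynomial.eval_map]
    exact hz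
  have hle := Finset.le_sup (f := fun r : LaurentSeries F => (r - y).order.natAbs) hmem
  set M := q.roots.toFinset.sup fun r => (r - y).order.natAbs
  have hzy : z - y ≠ 0 := sub_ne_zero.2 hne
  have hw0 : w ≠ 0 := by
    rintro rfl
    rw [mul_zero] at h
    exact mul_ne_zero (pow_ne_zero _ h0) hzy h
  have ho := congrArg HahnSeries.order h
  rw [HahnSeries.order_mul (pow_ne_zero _ h0) hzy, HahnSeries.order_mul (pow_ne_zero _ h0) hw0,
    HahnSeries.order_pow, HahnSeries.order_pow, h1] at ho
  rw [isO_order hw0] at hw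
  simp only [nsmul_eq_mul, mul_one] at ho
  push_cast at ho
  omega

theorem bi_aut (σ : LaurentSeries F ≃ₐ[F] LaurentSeries F) (Q : Polynomial (Polynomial F))
    (s y : LaurentSeries F) : σ (bi Q s y) = bi Q (σ s) (σ y) := by
  unfold bi
  refine (Polynomial.hom_eval₂ Q _ (σ : LaurentSeries F →+* LaurentSeries F) y).trans ?_
  congr 1
  refine Polynomial.ringHom_ext (fun c => ?_) ?_
  · simp
  · simp

theorem main_forward [PerfectField F] (m : ℕ)
    (a x : Fin m → LaurentSeries F) (j : Fin m)
    (hj : Transcendental F (a j))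
    (halg : ∀ i : Fin m, IsAlgebraic (IntermediateField.adjoin F {a j}) (a i))
    (H : ∀ φ : (Lvf F).Formula (Fin m), φ.Realize a ↔ φ.Realize x) :
    ∃ σ : LaurentSeries F ≃ₐ[F] LaurentSeries F, ∀ i, σ (a i) = x i := by
  obtain ⟨s, hs, hjs⟩ := exists_unif hj
  have hle : IntermediateField.adjoin F {a j} ≤ IntermediateField.adjoin F {s} := by
    rw [IntermediateField.adjoin_le_iff]
    simpa using hjs
  have halg' : ∀ i, IsAlgebraic (IntermediateField.adjoin F {s}) (a i) := fun i =>
    IsAlgebraic.tower_top_of_subalgebra_le (A := (IntermediateField.adjoin F {a j}).toSubalgebra)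
      (B := (IntermediateField.adjoin F {s}).toSubalgebra) hle (halg i)
  choose Q hQ hQa using fun i => exists_bi (halg' i)
  choose N hN using fun i => unique (y := a i) hs (hQ i)
  choose k c w hw hk using fun i => approx hs (a i) (N i)
  have hD : Dfn F (
      fun u : Fin m ⊕ Option (Fin m) → LaurentSeries F =>
        Unif (u (Sum.inr none)) ∧ ∀ i : Fin m,
          bi (Q i) (u (Sum.inr none)) (u (Sum.inl i)) = 0 ∧ isO (u (Sum.inr (some i))) ∧
          u (Sum.inr none) ^ k i * u (Sum.inl i) =
            Polynomial.aeval (u (Sum.inr none)) (c i) +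
              u (Sum.inr none) ^ (N i + k i) * u (Sum.inr (some i))) := by
    refine (Dfn.unif _).and (Dfn.forallFin fun i => ?_)
    have hn : Rep F (fun u : Fin m ⊕ Option (Fin m) → LaurentSeries F => u (Sum.inr none)) :=
      .var _
    have hi : Rep F (fun u : Fin m ⊕ Option (Fin m) → LaurentSeries F => u (Sum.inl i)) :=
      .var _
    have hv : Rep F (fun u : Fin m ⊕ Option (Fin m) → LaurentSeries F => u (Sum.inr (some i))) :=
      .var _
    exact (Dfn.eq (hn.bi hi (Q i)) .zero).and ((Dfn.isO hv).and
      (Dfn.eq ((hn.pow _).mul hi) ((hn.poly (c i)).add ((hn.pow _).mul hv))))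
  obtain ⟨φ, hφ⟩ := hD.ex
  have hx := (hφ x).1 ((H φ).1 ((hφ a).2
    ⟨fun o => o.elim s w, hs, fun i => ⟨hQa i, hw i, hk i⟩⟩))
  obtain ⟨w', hu, hi⟩ := hx
  simp only [Sum.elim_inr, Sum.elim_inl] at hu hi
  obtain ⟨σ₁, h₁⟩ := unif_aut hs
  obtain ⟨σ₂, h₂⟩ := unif_aut hu
  let ρ := σ₂.symm.trans σ₁
  have hρ : ρ (w' none) = s := by
    change σ₁ (σ₂.symm (w' none)) = s
    rw [← h₂, AlgEquiv.symm_apply_apply, h₁]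
  refine ⟨ρ.symm, fun i => ?_⟩
  rw [AlgEquiv.symm_apply_eq]
  symm
  obtain ⟨e1, e2, e3⟩ := hi i
  refine hN i (ρ (x i)) (ρ (w' (some i)) - w i) (k i) ?_ ?_ ?_
  · rw [← hρ, ← bi_aut, e1, map_zero]
  · rw [sub_eq_add_neg]
    refine isO_add (aut_isO ρ e2) ?_
    intro n hn
    rw [HahnSeries.coeff_neg, hw i n hn, neg_zero]
  · have e4 := congrArg ρ e3
    rw [map_mul, map_add, map_mul, map_pow, map_pow, hρ] at e4
    have e5 : ρ (Polynomial.aeval (w' none) (c i)) = Polynomial.aeval s (c i) := by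
      rw [← hρ]
      exact (Polynomial.aeval_algHom_apply ρ.toAlgHom _ _).symm
    rw [e5] at e4
    rw [mul_sub, mul_sub, e4, hk i]
    ring

end final
end S16
/-- for a tuple `a` from `F((t))` of transcendence degree `1` over the
perfect field `F`, the orbit of `a` under `F`-automorphisms of `F((t))` coincides with
the set of realisations of the complete `L_vf(F)`-type of `a`: a tuple `x` satisfies
exactly the same `L_vf(F)`-formulas as `a` if and only if it is conjugate to `a` by an
`F`-automorphism. -/
theorem statement16 (F : Type*) [Field F] [PerfectField F] (m : ℕ)
    (a x : Fin m → LaurentSeries F) (j : Fin m)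
    (hj : Transcendental F (a j))
    (halg : ∀ i : Fin m, IsAlgebraic (IntermediateField.adjoin F {a j}) (a i)) :
    (∀ φ : (Lvf F).Formula (Fin m), φ.Realize a ↔ φ.Realize x) ↔
    (∃ σ : LaurentSeries F ≃ₐ[F] LaurentSeries F, ∀ i, σ (a i) = x i) := by
  constructor
  · exact S16.main_forward m a x j hj halg
  · rintro ⟨σ, hσ⟩ φ
    obtain rfl : (fun i => σ (a i)) = x := funext hσ
    exact (S16.realize_aut σ φ a).symm
end

section
/- Let F be a perfect field of characteristic p > 0 and let X be a subset of F((t)) definable without parameters (over F) in the valued field language, closed under all F-automorphisms of F((t)). If X ⊄ F, then the subfield of F((t)) generated by X equals F((t^{p^n})) for some n < ω. -/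
open FirstOrder Language

theorem s17_fix {F : Type*} [Field F] (G : PowerSeries F → PowerSeries F)
    (hG : ∀ k a b, PowerSeries.X ^ k ∣ a - b →
      PowerSeries.X ^ (k + 1) ∣ G a - G b - (a - b)) (g : PowerSeries F) :
    ∃ a, G a = g := by
  let s : ℕ → PowerSeries F := fun n => Nat.rec 0 (fun _ a => a + (g - G a)) n
  have hs : ∀ n, s (n + 1) = s n + (g - G (s n)) := fun n => rfl
  have h1 : ∀ n, PowerSeries.X ^ n ∣ g - G (s n) := by
    intro n
    induction n with
    | zero => simp
    | succ n ih =>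
      have h : PowerSeries.X ^ n ∣ s (n + 1) - s n := by
        rw [hs]; simpa using ih
      have h2 := hG n _ _ h
      have : g - G (s (n + 1)) = -(G (s (n + 1)) - G (s n) - (s (n + 1) - s n)) := by
        rw [hs]; ring
      rw [this]
      exact (dvd_neg).2 h2
  have h2 : ∀ m n, PowerSeries.X ^ m ∣ s (m + n) - s m := by
    intro m n
    induction n with
    | zero => simp
    | succ n ih =>
      have : s (m + (n + 1)) - s m = (s (m + n) - s m) + (g - G (s (m + n))) := by
        rw [← add_assoc, hs]; ring
      rw [this]
      exact dvd_add ih ((pow_dvd_pow _ (by omega)).trans (h1 (m + n)))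
  let a : PowerSeries F := PowerSeries.mk fun n => PowerSeries.coeff n (s (n + 1))
  have ha : ∀ m, PowerSeries.X ^ m ∣ a - s m := by
    intro m
    rw [PowerSeries.X_pow_dvd_iff]
    intro i hi
    obtain ⟨d, rfl⟩ := Nat.exists_eq_add_of_lt hi
    have := (PowerSeries.X_pow_dvd_iff.1 (h2 (i + 1) d)) i (by omega)
    rw [show i + d + 1 = i + 1 + d by omega]
    simp only [map_sub, a, PowerSeries.coeff_mk] at this ⊢
    rw [← neg_eq_zero, ← this]; ring
  refine ⟨a, ?_⟩
  rw [← sub_eq_zero]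
  ext i
  have h3 := hG (i + 1) _ _ (ha (i + 1))
  have h4 : PowerSeries.X ^ (i + 1) ∣ G a - g := by
    have : G a - g = (G a - G (s (i + 1)) - (a - s (i + 1))) + (a - s (i + 1))
      - (g - G (s (i + 1))) := by ring
    rw [this]
    exact dvd_sub (dvd_add ((pow_dvd_pow _ (by omega)).trans h3) (ha _)) (h1 _)
  rw [PowerSeries.X_pow_dvd_iff.1 h4 i (by omega)]; simp

theorem s17_taylor {F : Type*} [Field F] (y a b : PowerSeries F) (N k : ℕ)
    (ha : PowerSeries.constantCoeff a = 0) (hb : PowerSeries.constantCoeff b = 0)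
    (hbX : PowerSeries.X ^ N ∣ b - PowerSeries.X) (hab : PowerSeries.X ^ (N + k) ∣ a - b) :
    PowerSeries.X ^ (2 * N + k) ∣ PowerSeries.subst a y - PowerSeries.subst b y
      - PowerSeries.derivative F y * (a - b) := by
  have key : ∀ c : PowerSeries F, PowerSeries.constantCoeff c = 0 → ∀ M,
      PowerSeries.X ^ M ∣ PowerSeries.subst c y - 
        Polynomial.aeval c (PowerSeries.trunc M y) := by
    intro c hc M
    have hs : PowerSeries.HasSubst c := PowerSeries.HasSubst.of_constantCoeff_zero' hc
    have h := PowerSeries.eq_X_pow_mul_shift_add_trunc M y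
    set r := PowerSeries.mk fun i => PowerSeries.coeff (i + M) y
    have h2 : PowerSeries.subst c y = c ^ M * PowerSeries.subst c r
        + Polynomial.aeval c (PowerSeries.trunc M y) := by
      conv_lhs => rw [h]
      rw [PowerSeries.subst_add hs, PowerSeries.subst_mul hs, PowerSeries.subst_pow hs,
        PowerSeries.subst_X hs, PowerSeries.subst_coe hs]
    rw [h2, add_sub_cancel_right]
    exact Dvd.dvd.mul_right (pow_dvd_pow_of_dvd (PowerSeries.X_dvd_iff.2 hc) M) _
  set M := 2 * N + k with hM
  set P := PowerSeries.trunc (M + 1) y with hP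
  have hda : PowerSeries.X ^ M ∣ PowerSeries.subst a y - Polynomial.aeval a P :=
    (pow_dvd_pow _ (by omega)).trans (key a ha (M + 1))
  have hdb : PowerSeries.X ^ M ∣ PowerSeries.subst b y - Polynomial.aeval b P :=
    (pow_dvd_pow _ (by omega)).trans (key b hb (M + 1))
  have hd : PowerSeries.X ^ M ∣ PowerSeries.derivative F y
      - ((Polynomial.derivative P : Polynomial F) : PowerSeries F) := by
    rw [PowerSeries.X_pow_dvd_iff]
    intro i hi
    rw [map_sub, PowerSeries.coeff_derivative, Polynomial.coeff_coe, Polynomial.coeff_derivative,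
      hP, PowerSeries.coeff_trunc, if_pos (by omega), sub_self]
  let Q := P.map (algebraMap F (PowerSeries F))
  have hQ : ∀ c, Polynomial.aeval c P = Q.eval c := fun c => by
    simp only [Q, Polynomial.eval_map_algebraMap]
  have hQd : ((Polynomial.derivative P : Polynomial F) : PowerSeries F)
      = (Polynomial.derivative Q).eval PowerSeries.X := by
    simp only [Q, Polynomial.derivative_map, Polynomial.eval_map_algebraMap]
    have := PowerSeries.subst_coe (PowerSeries.HasSubst.X' (R := F)) (Polynomial.derivative P)
    rw [PowerSeries.X_subst] at this
    exact this
  obtain ⟨z, hz⟩ := Polynomial.binomExpansion Q b (a - b)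
  obtain ⟨w, hw⟩ := Polynomial.evalSubFactor (Polynomial.derivative Q) b PowerSeries.X
  rw [add_sub_cancel] at hz
  rw [hQ] at hda hdb
  rw [hQd] at hd
  have : PowerSeries.subst a y - PowerSeries.subst b y - PowerSeries.derivative F y * (a - b)
     = (PowerSeries.subst a y - Q.eval a) - (PowerSeries.subst b y - Q.eval b)
      - (PowerSeries.derivative F y - (Polynomial.derivative Q).eval PowerSeries.X) * (a - b)
      + w * ((b - PowerSeries.X) * (a - b)) + z * ((a - b) * (a - b)) := by
    rw [hz]; linear_combination (a - b) * hw
  rw [this]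
  have e1 : PowerSeries.X ^ M ∣ (b - PowerSeries.X) * (a - b) := by
    rw [show M = N + (N + k) by omega, pow_add]; exact mul_dvd_mul hbX hab
  have e2 : PowerSeries.X ^ M ∣ (a - b) * (a - b) := by
    refine dvd_trans ?_ (mul_dvd_mul hab hab)
    rw [← pow_add]; exact pow_dvd_pow _ (by omega)
  exact dvd_add (dvd_add (dvd_sub (dvd_sub hda hdb) (hd.mul_right _)) (e1.mul_left _))
    (e2.mul_left _)

theorem s17_algMap {F : Type*} [Field F] (r : F) : algebraMap F (LaurentSeries F) r
    = algebraMap (PowerSeries F) (LaurentSeries F) (algebraMap F (PowerSeries F) r) := by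
  rw [LaurentSeries.coe_algebraMap, HahnSeries.algebraMap_apply']

theorem s17_aut {F : Type*} [Field F] (s : PowerSeries F)
    (h0 : PowerSeries.constantCoeff s = 0) (h1 : IsUnit (PowerSeries.coeff 1 s)) :
    ∃ σ : LaurentSeries F ≃ₐ[F] LaurentSeries F, ∀ y : PowerSeries F,
      σ (algebraMap (PowerSeries F) (LaurentSeries F) y)
        = algebraMap (PowerSeries F) (LaurentSeries F) (PowerSeries.subst s y) := by
  have hs : PowerSeries.HasSubst s := PowerSeries.HasSubst.of_constantCoeff_zero' h0
  have hs' := PowerSeries.HasSubst.substInvOfIsUnit s h1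
  let f : PowerSeries F →ₐ[F] PowerSeries F := PowerSeries.substAlgHom hs
  let g : PowerSeries F →ₐ[F] PowerSeries F := PowerSeries.substAlgHom hs'
  have hf : ∀ y, f y = PowerSeries.subst s y := fun y => by
    simp only [f]; rw [PowerSeries.coe_substAlgHom]
  have hg : ∀ y, g y = PowerSeries.subst (s.substInvOfIsUnit h1) y := fun y => by
    simp only [g]; rw [PowerSeries.coe_substAlgHom]
  let e : PowerSeries F ≃ₐ[F] PowerSeries F := AlgEquiv.ofAlgHom f g
    (by
      ext1 y
      simp only [AlgHom.comp_apply, hf, hg]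
      rw [PowerSeries.subst_comp_subst_apply hs' hs,
        PowerSeries.subst_substInvOfIsUnit_left s h0 h1, PowerSeries.X_subst]; rfl)
    (by
      ext1 y
      simp only [AlgHom.comp_apply, hf, hg]
      rw [PowerSeries.subst_comp_subst_apply hs hs',
        PowerSeries.subst_substInvOfIsUnit_right s h0 h1, PowerSeries.X_subst]; rfl)
  have hr : ∀ y : PowerSeries F, (IsFractionRing.ringEquivOfRingEquiv e.toRingEquiv :
      LaurentSeries F ≃+* LaurentSeries F) (algebraMap (PowerSeries F) (LaurentSeries F) y)
        = algebraMap (PowerSeries F) (LaurentSeries F) (e y) := fun y =>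
    IsFractionRing.ringEquivOfRingEquiv_algebraMap _ _
  refine ⟨AlgEquiv.ofRingEquiv (f := (IsFractionRing.ringEquivOfRingEquiv e.toRingEquiv :
      LaurentSeries F ≃+* LaurentSeries F)) (fun r => ?_), fun y => ?_⟩
  · rw [s17_algMap, hr, e.commutes]
  · rw [AlgEquiv.ofRingEquiv_apply, hr, ← hf]
    rfl

/-- If the derivative of `y` is nonzero, then a subfield containing all conjugates of `y`
under `F`-automorphisms is the whole field. -/
theorem s17_core {F : Type*} [Field F] (K : Subfield (LaurentSeries F)) (y : PowerSeries F)
    (hy : PowerSeries.derivative F y ≠ 0)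
    (hK : ∀ σ : LaurentSeries F ≃ₐ[F] LaurentSeries F,
      σ (algebraMap (PowerSeries F) (LaurentSeries F) y) ∈ K) : K = ⊤ := by
  obtain ⟨m, u, hu⟩ : ∃ (m : ℕ) (u : (PowerSeries F)ˣ),
      PowerSeries.derivative F y = PowerSeries.X ^ m * (u : PowerSeries F) := by
    refine ⟨(PowerSeries.derivative F y).order.toNat, PowerSeries.Unit_of_divided_by_X_pow_order (PowerSeries.derivative F y), ?_⟩
    rw [PowerSeries.Unit_of_divided_by_X_pow_order_nonzero hy]
    exact (PowerSeries.X_pow_order_mul_divXPowOrder).symm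
  set N := m + 2 with hN
  have hc : ∀ α : PowerSeries F,
      PowerSeries.constantCoeff (PowerSeries.X + PowerSeries.X ^ N * α) = 0 := by
    intro α; simp [hN]
  have hc1 : ∀ α : PowerSeries F,
      PowerSeries.coeff 1 (PowerSeries.X + PowerSeries.X ^ N * α) = 1 := by
    intro α
    rw [map_add, PowerSeries.coeff_X_pow_mul', if_neg (by omega)]; simp
  have hdiv : ∀ k (α β : PowerSeries F), PowerSeries.X ^ k ∣ α - β →
      PowerSeries.X ^ (m + N + (k + 1)) ∣
        PowerSeries.subst (PowerSeries.X + PowerSeries.X ^ N * α) y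
        - PowerSeries.subst (PowerSeries.X + PowerSeries.X ^ N * β) y
        - PowerSeries.X ^ (m + N) * ((u : PowerSeries F) * (α - β)) := by
    intro k α β h
    have := s17_taylor y _ _ N k (hc α) (hc β) (by simp)
      (by rw [add_sub_add_left_eq_sub, ← mul_sub, pow_add]; exact mul_dvd_mul_left _ h)
    rw [add_sub_add_left_eq_sub, ← mul_sub, hu] at this
    refine (pow_dvd_pow _ (by omega)).trans (this.trans (dvd_of_eq ?_))
    ring
  have hex : ∀ α : PowerSeries F, ∃ γ,
      PowerSeries.subst (PowerSeries.X + PowerSeries.X ^ N * α) y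
        - PowerSeries.subst (PowerSeries.X + PowerSeries.X ^ N * 0) y
        = PowerSeries.X ^ (m + N) * γ := by
    intro α
    have := hdiv 0 α 0 (by simp)
    have h2 := (dvd_sub_left (dvd_mul_right _ _)).1 ((pow_dvd_pow PowerSeries.X
      (show m + N ≤ m + N + (0 + 1) by omega)).trans this)
    exact h2
  choose G hG using hex
  have hXne : (PowerSeries.X : PowerSeries F) ^ (m + N) ≠ 0 :=
    pow_ne_zero _ PowerSeries.X_ne_zero
  have hsurj : ∀ g, ∃ α, (↑u⁻¹ : PowerSeries F) * G α = g := by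
    apply s17_fix
    intro k α β h
    have h1 := hdiv k α β h
    have h2 : PowerSeries.subst (PowerSeries.X + PowerSeries.X ^ N * α) y
        - PowerSeries.subst (PowerSeries.X + PowerSeries.X ^ N * β) y
        - PowerSeries.X ^ (m + N) * ((u : PowerSeries F) * (α - β))
        = PowerSeries.X ^ (m + N) * (G α - G β - (u : PowerSeries F) * (α - β)) := by
      linear_combination hG α - hG β
    rw [h2, pow_add, mul_dvd_mul_iff_left hXne] at h1
    have h3 : (↑u⁻¹ : PowerSeries F) * G α - ↑u⁻¹ * G β - (α - β)
        = ↑u⁻¹ * (G α - G β - (u : PowerSeries F) * (α - β)) := by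
      have := u.inv_mul
      linear_combination (α - β) * this
    rw [h3]
    exact h1.mul_left _
  have hball : ∀ g : PowerSeries F,
      algebraMap (PowerSeries F) (LaurentSeries F) (PowerSeries.X ^ (m + N) * g) ∈ K := by
    intro g
    obtain ⟨α, hα⟩ := hsurj (↑u⁻¹ * g)
    have hα' : G α = g := by
      have := congrArg (fun z => (u : PowerSeries F) * z) hα
      simpa using this
    rw [← hα', ← hG, map_sub]
    have hmem : ∀ β : PowerSeries F, algebraMap (PowerSeries F) (LaurentSeries F)
        (PowerSeries.subst (PowerSeries.X + PowerSeries.X ^ N * β) y) ∈ K := by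
      intro β
      obtain ⟨σ, hσ⟩ := s17_aut (PowerSeries.X + PowerSeries.X ^ N * β) (hc β)
        (by rw [hc1]; exact isUnit_one)
      rw [← hσ]; exact hK σ
    exact K.sub_mem (hmem _) (hmem _)
  rw [eq_top_iff]
  intro f _
  obtain ⟨a, b, hb, rfl⟩ := IsFractionRing.div_surjective (A := PowerSeries F) f
  have hb0 : algebraMap (PowerSeries F) (LaurentSeries F) b ≠ 0 := by
    rw [Ne, FaithfulSMul.algebraMap_eq_zero_iff]; exact nonZeroDivisors.ne_zero hb
  have hX0 : algebraMap (PowerSeries F) (LaurentSeries F) (PowerSeries.X ^ (m + N)) ≠ 0 := by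
    rw [Ne, FaithfulSMul.algebraMap_eq_zero_iff]; exact hXne
  have := K.div_mem (hball a) (hball b)
  rwa [map_mul, map_mul, mul_div_mul_left _ _ hX0] at this

theorem s17_pow_coeff {F : Type*} [Field F] (p : ℕ) [Fact (Nat.Prime p)] [CharP F p]
    (R : PowerSeries F) (n i : ℕ) :
    PowerSeries.coeff i (R ^ p ^ n) =
      if p ^ n ∣ i then (PowerSeries.coeff (i / p ^ n) R) ^ p ^ n else 0 := by
  have hp : p ≠ 0 := (Fact.out : p.Prime).ne_zero
  have h : PowerSeries.map (iterateFrobenius F p n)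
      (PowerSeries.expand (p ^ n) (pow_ne_zero n hp) R) = R ^ p ^ n :=
    MvPowerSeries.map_iterateFrobenius_expand p hp R n
  rw [← h, PowerSeries.coeff_map, PowerSeries.coeff_expand]
  split_ifs
  · rw [iterateFrobenius_def]
  · simp

theorem s17_form {F : Type*} [Field F] (x : LaurentSeries F) :
    ∃ (k : ℕ) (P : PowerSeries F), x = HahnSeries.single (-(k : ℤ)) 1 *
      HahnSeries.ofPowerSeries ℤ F P := by
  refine ⟨(-x.order).toNat, PowerSeries.X ^ (x.order).toNat * x.powerSeriesPart, ?_⟩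
  rw [map_mul, HahnSeries.ofPowerSeries_X_pow, ← mul_assoc, HahnSeries.single_mul_single, one_mul,
    show -(((-x.order).toNat : ℕ) : ℤ) + ((x.order.toNat : ℕ) : ℤ) = x.order by omega,
    LaurentSeries.single_order_mul_powerSeriesPart]

theorem s17_form_coeff {F : Type*} [Field F] (k : ℕ) (P : PowerSeries F) (i : ℤ) :
    (HahnSeries.single (-(k : ℤ)) 1 * HahnSeries.ofPowerSeries ℤ F P : LaurentSeries F).coeff i
      = if i + k < 0 then 0 else PowerSeries.coeff (i + k).natAbs P := by
  have h := HahnSeries.coeff_single_mul_add (r := (1 : F))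
    (x := HahnSeries.ofPowerSeries ℤ F P) (a := i + k) (b := -(k : ℤ))
  rw [show i + k + -(k : ℤ) = i by omega, one_mul] at h
  rw [h, PowerSeries.coeff_coe]

theorem s17_range {F : Type*} [Field F] (p : ℕ) [Fact (Nat.Prime p)] [CharP F p]
    [PerfectRing F p] (n : ℕ) (x : LaurentSeries F) :
    (∃ z, z ^ p ^ n = x) ↔ ∀ i : ℤ, x.coeff i ≠ 0 → ((p : ℤ) ^ n ∣ i) := by
  have hp : 0 < p ^ n := pow_pos (Fact.out : p.Prime).pos n
  constructor
  · rintro ⟨z, rfl⟩ i hi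
    obtain ⟨k, R, rfl⟩ := s17_form z
    rw [mul_pow, HahnSeries.single_pow, ← map_pow, one_pow, smul_neg, nsmul_eq_mul,
      ← Nat.cast_mul, s17_form_coeff, s17_pow_coeff] at hi
    have h1 : ¬ (i + ((p ^ n * k : ℕ) : ℤ) < 0) := fun h => hi (if_pos h)
    rw [if_neg h1] at hi
    have h2 : p ^ n ∣ (i + ((p ^ n * k : ℕ) : ℤ)).natAbs := by
      by_contra h; exact hi (if_neg h)
    rw [← Int.natCast_dvd, ] at h2
    push_cast at h2
    exact (dvd_add_left (dvd_mul_right _ _)).1 h2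
  · intro h
    obtain ⟨k, P, hP⟩ := s17_form x
    -- normalise the exponent to a multiple of q
    obtain ⟨k', Q, hQ⟩ : ∃ (k : ℕ) (P : PowerSeries F),
        x = HahnSeries.single (-((p ^ n * k : ℕ) : ℤ)) 1 * HahnSeries.ofPowerSeries ℤ F P := by
      refine ⟨k, PowerSeries.X ^ (p ^ n * k - k) * P, ?_⟩
      have : k ≤ p ^ n * k := Nat.le_mul_of_pos_left k hp
      rw [hP, map_mul, HahnSeries.ofPowerSeries_X_pow, ← mul_assoc, HahnSeries.single_mul_single,
        one_mul, Nat.cast_sub this]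
      congr 3
      ring
    let R : PowerSeries F := PowerSeries.mk fun i =>
      (iterateFrobeniusEquiv F p n).symm (PowerSeries.coeff (p ^ n * i) Q)
    refine ⟨HahnSeries.single (-(k' : ℤ)) 1 * HahnSeries.ofPowerSeries ℤ F R, ?_⟩
    rw [mul_pow, HahnSeries.single_pow, ← map_pow, one_pow, smul_neg, nsmul_eq_mul,
      ← Nat.cast_mul, hQ]
    congr 2
    ext i
    rw [s17_pow_coeff]
    split_ifs with hd
    · obtain ⟨j, rfl⟩ := hd
      rw [Nat.mul_div_cancel_left _ hp, PowerSeries.coeff_mk, ← iterateFrobeniusEquiv_def,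
        RingEquiv.apply_symm_apply]
    · by_contra hne
      apply hd
      have := h ((i : ℤ) - ((p ^ n * k' : ℕ) : ℤ)) (by
        rw [hQ, s17_form_coeff, sub_add_cancel, if_neg (by omega), Int.natAbs_natCast]
        exact fun h => hne h.symm)
      push_cast at this
      rw [dvd_sub_left (dvd_mul_right _ _)] at this
      exact_mod_cast this

theorem s17_gen {F : Type*} [Field F] (p : ℕ) [Fact (Nat.Prime p)] [CharP F p]
    [PerfectRing F p] (K : Subfield (LaurentSeries F)) (y : LaurentSeries F)
    (hy : ¬ ∃ z, z ^ p = y)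
    (hK : ∀ σ : LaurentSeries F ≃ₐ[F] LaurentSeries F, σ y ∈ K) : K = ⊤ := by
  have main : ∀ P : PowerSeries F,
      (¬ ∃ z, z ^ p = algebraMap (PowerSeries F) (LaurentSeries F) P) →
      (∀ σ : LaurentSeries F ≃ₐ[F] LaurentSeries F,
        σ (algebraMap (PowerSeries F) (LaurentSeries F) P) ∈ K) → K = ⊤ := by
    intro P hP hPK
    refine s17_core K P (fun h0 => hP ?_) hPK
    have := (s17_range p 1 (algebraMap (PowerSeries F) (LaurentSeries F) P)).2 ?_
    · simpa only [pow_one] using this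
    intro i hi
    rw [pow_one]
    rw [LaurentSeries.coe_algebraMap, PowerSeries.coeff_coe] at hi
    have hi0 : ¬ i < 0 := fun h => hi (if_pos h)
    rw [if_neg hi0] at hi
    obtain ⟨j, rfl⟩ := Int.eq_ofNat_of_zero_le (not_lt.1 hi0)
    rw [Int.natAbs_natCast] at hi
    rw [Int.natCast_dvd_natCast]
    cases j with
    | zero => exact dvd_zero _
    | succ j =>
      have h1 := congrArg (PowerSeries.coeff j) h0
      rw [PowerSeries.coeff_derivative, map_zero] at h1
      have h2 := (mul_eq_zero.1 h1).resolve_left hi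
      rw [← CharP.cast_eq_zero_iff F p]
      push_cast; exact h2
  obtain ⟨k, P, hP⟩ := s17_form y
  by_cases ho : ∃ P : PowerSeries F, algebraMap (PowerSeries F) (LaurentSeries F) P = y
  · obtain ⟨P, rfl⟩ := ho
    exact main P hy hK
  · obtain ⟨P, hP⟩ : ∃ P : PowerSeries F,
        algebraMap (PowerSeries F) (LaurentSeries F) P = y⁻¹ := by
      have hord : 0 ≤ y⁻¹.order := by
        by_contra hneg
        apply ho
        have hy0 : y ≠ 0 := by rintro rfl; simp at hneg
        have h3 := HahnSeries.order_mul hy0 (inv_ne_zero hy0)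
        rw [mul_inv_cancel₀ hy0, HahnSeries.order_one] at h3
        exact ⟨_, LaurentSeries.X_order_mul_powerSeriesPart (n := y.order.toNat) (by omega)⟩
      exact ⟨_, LaurentSeries.X_order_mul_powerSeriesPart (n := y⁻¹.order.toNat) (by omega)⟩
    refine main P ?_ ?_
    · rw [hP]
      rintro ⟨z, hz⟩
      exact hy ⟨z⁻¹, by rw [inv_pow, hz, inv_inv]⟩
    · intro σ
      rw [hP, map_inv₀]
      exact K.inv_mem (hK σ)

/-- let `F` be perfect of characteristic `p > 0` and let `X ⊆ F((t))` be
definable without parameters (over `F`) in the valued field language, closed under all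
`F`-automorphisms of `F((t))`. If `X ⊄ F` then the subfield generated by `X` is
`F((t^{p^n}))` for some `n`, i.e. the subfield of Laurent series supported on multiples
of `p^n`. -/
theorem statement17 (F : Type*) [Field F] (p : ℕ) [Fact (Nat.Prime p)] [CharP F p]
    [PerfectRing F p] (X : Set (LaurentSeries F))
    (hdef : ∃ φ : (Lvf F).Formula (Fin 1), X = {x : LaurentSeries F | φ.Realize (fun _ => x)})
    (hclosed : ∀ σ : LaurentSeries F ≃ₐ[F] LaurentSeries F, ∀ x ∈ X, σ x ∈ X)
    (hX : ¬ X ⊆ Set.range (algebraMap F (LaurentSeries F))) :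
    ∃ n : ℕ, (Subfield.closure X : Set (LaurentSeries F))
      = {f : LaurentSeries F | ∀ i : ℤ, f.coeff i ≠ 0 → ((p : ℤ) ^ n ∣ i)} := by
  classical
  have : CharP (LaurentSeries F) p :=
    charP_of_injective_algebraMap (algebraMap F (LaurentSeries F)).injective p
  have hp : 1 < p := (Fact.out : p.Prime).one_lt
  -- some level is reached
  have hex : ∃ n : ℕ, ∃ x ∈ X, ¬ ∃ z, z ^ p ^ (n + 1) = x := by
    obtain ⟨x, hxX, hx⟩ := Set.not_subset.1 hX
    by_contra! hcon
    apply hx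
    refine ⟨x.coeff 0, ?_⟩
    rw [s17_algMap, LaurentSeries.coe_algebraMap, ← PowerSeries.C_eq_algebraMap,
      HahnSeries.ofPowerSeries_C]
    ext i
    rw [HahnSeries.C_apply]
    by_cases hi : i = 0
    · subst hi; rw [HahnSeries.coeff_single_same]
    rw [HahnSeries.coeff_single_of_ne hi]
    by_contra hne
    have h1 := (s17_range p (i.natAbs + 1) x).1 (hcon i.natAbs x hxX) i (Ne.symm hne)
    have h2 : p ^ (i.natAbs + 1) ∣ i.natAbs := by
      rw [← Int.natCast_dvd]; exact_mod_cast h1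
    have h3 := Nat.le_of_dvd (by omega) h2
    have h4 := Nat.lt_pow_self hp (n := i.natAbs + 1)
    omega
  let n := Nat.find hex
  obtain ⟨x, hxX, hx⟩ := Nat.find_spec hex
  have hall : ∀ w ∈ X, ∃ z, z ^ p ^ n = w := by
    intro w hw
    rcases Nat.eq_zero_or_pos n with h0 | h0
    · exact ⟨w, by rw [h0]; simp⟩
    · have := Nat.find_min hex (m := n - 1) (by omega)
      push Not at this
      have h2 := this w hw
      rwa [show n - 1 + 1 = n by omega] at h2
  refine ⟨n, ?_⟩
  ext f
  rw [Set.mem_ofPred_eq, ← s17_range p n f]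
  let φ : LaurentSeries F →+* LaurentSeries F := iterateFrobenius (LaurentSeries F) p n
  have hφ : ∀ z, φ z = z ^ p ^ n := fun z => iterateFrobenius_def p n z
  constructor
  · intro hf
    have hle : Subfield.closure X ≤ φ.fieldRange := by
      rw [Subfield.closure_le]
      intro w hw
      obtain ⟨z, hz⟩ := hall w hw
      exact ⟨z, by rw [hφ, hz]⟩
    obtain ⟨z, hz⟩ := hle hf
    exact ⟨z, by rw [← hφ, hz]⟩
  · rintro ⟨z, rfl⟩
    obtain ⟨y, hy⟩ := hall x hxX
    have htop : (Subfield.closure X).comap φ = ⊤ := by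
      refine s17_gen p _ y ?_ ?_
      · rintro ⟨w, hw⟩
        exact hx ⟨w, by rw [← hy, ← hw, ← pow_mul, pow_succ']⟩
      · intro σ
        rw [Subfield.mem_comap, hφ, ← map_pow, hy]
        exact Subfield.subset_closure (hclosed σ x hxX)
    have : z ∈ (Subfield.closure X).comap φ := by rw [htop]; trivial
    rw [Subfield.mem_comap, hφ] at this
    exact this
end
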